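/- arXiv:1303.2753 — 2 statements merged into one kernel-verified Lean document; each statement's English description precedes it below -/
import Mathlib

section
/- Every planar graph with no cycle of length 3 (i.e., every triangle-free planar graph) is (3,1)-choosable. -/
open Set

namespace ChoosSep

/-- `G` has a cycle of length `n`. -/
def HasCycleLen {V : Type} (G : SimpleGraph V) (n : ℕ) : Prop :=
  ∃ (v : V) (c : G.Walk v v), c.IsCycle ∧ c.length = n

/-- `G` has a proper coloring choosing each color from the list `L v`. -/
def ColorableWith {V : Type} (G : SimpleGraph V) (L : V → Finset ℕ) : Prop :=
  ∃ φ : V → ℕ, (∀ v, φ v ∈ L v) ∧ ∀ ⦃u v⦄, G.Adj u v → φ u ≠ φ v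

/-- `G` is `(k,d)`-choosable: it has an `L`-coloring for every list assignment
giving each vertex at least `k` colors and any two adjacent vertices at most `d`
common colors. -/
def Choosable {V : Type} (G : SimpleGraph V) (k d : ℕ) : Prop :=
  ∀ L : V → Finset ℕ, (∀ v, k ≤ (L v).card) →
    (∀ ⦃u v⦄, G.Adj u v → ((L u) ∩ (L v)).card ≤ d) →
    ColorableWith G L

/-- The closed straight segment between two points of the plane. -/
def seg (x y : ℝ × ℝ) : Set (ℝ × ℝ) := segment ℝ x y

/-- A straight-line plane embedding of `G`: vertices go to distinct points, edges are
drawn as straight segments, two distinct edges meet only in common endpoints, and no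
vertex lies on the drawing of an edge it does not belong to.  By Fáry's theorem a
finite simple graph admits such an embedding iff it is planar. -/
structure PlaneEmb {V : Type} (G : SimpleGraph V) where
  pos : V → ℝ × ℝ
  inj : Function.Injective pos
  edges_meet : ∀ ⦃a b c d : V⦄, G.Adj a b → G.Adj c d → s(a, b) ≠ s(c, d) →
    seg (pos a) (pos b) ∩ seg (pos c) (pos d) ⊆ ({pos a, pos b} ∩ {pos c, pos d} : Set (ℝ × ℝ))
  vertex_off : ∀ ⦃a b v : V⦄, G.Adj a b → v ≠ a → v ≠ b → pos v ∉ seg (pos a) (pos b)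

/-- `G` is planar: it admits a plane embedding. -/
def IsPlanar {V : Type} (G : SimpleGraph V) : Prop := Nonempty (PlaneEmb G)

/-- A combinatorial sweep-line description of a noncrossing family of `x`-monotone arcs.
The vertices are numbered from left to right; `line i e` is the height of `e` on the vertical
line through vertex `i`, and `strip k e` its height between the vertices `k - 1` and `k`. -/
structure Sweep (E : Type) where
  left : E → ℕ
  right : E → ℕ
  height : ℕ → ℝ
  line : ℕ → E → ℝ
  strip : ℕ → E → ℝ
  left_lt_right : ∀ e, left e < right e
  line_left : ∀ e, line (left e) e = height (left e)
  line_right : ∀ e, line (right e) e = height (right e)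
  line_ne : ∀ i e, left e < i → i < right e → line i e ≠ height i
  line_eq : ∀ i e f, e ≠ f → left e ≤ i → i ≤ right e → left f ≤ i → i ≤ right f →
    line i e = line i f → line i e = height i
  strip_inj : ∀ k e f, left e < k → k ≤ right e → left f < k → k ≤ right f →
    strip k e = strip k f → e = f
  strip_lt : ∀ i e f, left e < i → i ≤ right e → left f < i → i ≤ right f →
    line i e < line i f → strip i e < strip i f
  strip_succ_lt : ∀ i e f, left e ≤ i → i < right e → left f ≤ i → i < right f →
    line i e < line i f → strip (i + 1) e < strip (i + 1) f

namespace Sweep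

variable {E : Type} (S : Sweep E)

/-- The arc `e` crosses the strip between the vertices `k - 1` and `k`. -/
def Active (k : ℕ) (e : E) : Prop := S.left e < k ∧ k ≤ S.right e

/-- `o` is the highest arc in strip `k` satisfying `P`, or `none` if there is no such arc. -/
def IsTop (k : ℕ) (P : E → Prop) : Option E → Prop
  | none => ∀ f, S.Active k f → ¬ P f
  | some b => S.Active k b ∧ P b ∧ ∀ f, S.Active k f → P f → S.strip k f ≤ S.strip k b

/-- In strip `k`, the arc `g` lies immediately above the arc `b`. -/
def Covers (k : ℕ) (b g : E) : Prop :=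
  S.Active k b ∧ S.Active k g ∧ S.strip k b < S.strip k g ∧
    ∀ f, S.Active k f → S.strip k f < S.strip k g → S.strip k f ≤ S.strip k b

variable {S}

theorem exists_isTop [Finite E] (k : ℕ) (P : E → Prop) : ∃ o, S.IsTop k P o := by
  classical
  have := Fintype.ofFinite E
  by_cases h : ∃ f, S.Active k f ∧ P f
  · obtain ⟨b, hb, hmax⟩ := Finset.exists_max_image
      (Finset.univ.filter fun f => S.Active k f ∧ P f) (S.strip k)
      (by obtain ⟨f, hf⟩ := h; exact ⟨f, by simpa using hf⟩)
    simp only [Finset.mem_filter, Finset.mem_univ, true_and] at hb hmax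
    exact ⟨some b, hb.1, hb.2, fun f hf hP => hmax f ⟨hf, hP⟩⟩
  · push Not at h
    exact ⟨none, h⟩

theorem IsTop.congr {k : ℕ} {P P' : E → Prop} (h : ∀ f, S.Active k f → (P f ↔ P' f))
    {o : Option E} (ho : S.IsTop k P o) : S.IsTop k P' o := by
  cases o with
  | none => exact fun f hf hP => ho f hf ((h f hf).2 hP)
  | some b =>
    exact ⟨ho.1, (h b ho.1).1 ho.2.1, fun f hf hP => ho.2.2 f hf ((h f hf).2 hP)⟩

theorem IsTop.unique {k : ℕ} {P : E → Prop} {o o' : Option E}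
    (ho : S.IsTop k P o) (ho' : S.IsTop k P o') : o = o' := by
  cases o with
  | none =>
    cases o' with
    | none => rfl
    | some b => exact absurd ho'.2.1 (ho b ho'.1)
  | some a =>
    cases o' with
    | none => exact absurd ho.2.1 (ho' a ho.1)
    | some b =>
      congr 1
      exact S.strip_inj k a b ho.1.1 ho.1.2 ho'.1.1 ho'.1.2
        (le_antisymm (ho'.2.2 a ho.1 ho.2.1) (ho.2.2 b ho'.1 ho'.2.1))

theorem covers_iff {k : ℕ} {b g : E} (hg : S.Active k g) :
    S.Covers k b g ↔ S.IsTop k (fun f => S.strip k f < S.strip k g) (some b) :=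
  ⟨fun h => ⟨h.1, h.2.2.1, h.2.2.2⟩, fun h => ⟨h.1, hg, h.2.1, h.2.2⟩⟩

theorem Covers.left_unique {k : ℕ} {b b' g : E} (h : S.Covers k b g) (h' : S.Covers k b' g) :
    b = b' :=
  Option.some.inj (((covers_iff h.2.1).1 h).unique ((covers_iff h.2.1).1 h'))

theorem Covers.right_unique {k : ℕ} {b g g' : E} (h : S.Covers k b g) (h' : S.Covers k b g') :
    g = g' := by
  obtain ⟨hb, hg, hlt, hc⟩ := h
  obtain ⟨-, hg', hlt', hc'⟩ := h'
  refine S.strip_inj k g g' hg.1 hg.2 hg'.1 hg'.2 (le_antisymm ?_ ?_)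
  · by_contra! hn
    exact absurd (hc g' hg' hn) (not_le.2 hlt')
  · by_contra! hn
    exact absurd (hc' g hg hn) (not_le.2 hlt)

/-- An arc of strip `k` which is not the highest one is covered by some arc. -/
theorem exists_covers [Finite E] {k : ℕ} {b : E} (hb : S.Active k b)
    (h : ¬ S.IsTop k (fun _ => True) (some b)) : ∃ g, S.Covers k b g := by
  classical
  have := Fintype.ofFinite E
  have h' : ∃ f, S.Active k f ∧ S.strip k b < S.strip k f := by
    by_contra! hn
    exact h ⟨hb, trivial, fun f hf _ => hn f hf⟩
  obtain ⟨g, hg, hmin⟩ := Finset.exists_min_image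
    (Finset.univ.filter fun f => S.Active k f ∧ S.strip k b < S.strip k f) (S.strip k)
    (by obtain ⟨f, hf⟩ := h'; exact ⟨f, by simpa using hf⟩)
  simp only [Finset.mem_filter, Finset.mem_univ, true_and] at hg hmin
  refine ⟨g, hb, hg.1, hg.2, fun f hf hlt => ?_⟩
  by_contra! hn
  exact absurd (hmin f ⟨hf, hn⟩) (not_le.2 hlt)

theorem line_ne_line {i : ℕ} {e f : E} (hef : e ≠ f) (he : S.left e < i) (he' : i < S.right e)
    (hf : S.left f ≤ i) (hf' : i ≤ S.right f) : S.line i e ≠ S.line i f :=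
  fun h => S.line_ne i e he he' (S.line_eq i e f hef he.le he'.le hf hf' h)

theorem strip_lt_iff {i : ℕ} {e f : E} (he : S.left e < i) (he' : i < S.right e)
    (hf : S.Active i f) : S.strip i f < S.strip i e ↔ S.line i f < S.line i e := by
  rcases eq_or_ne e f with rfl | hef
  · simp
  refine ⟨fun h => ?_, S.strip_lt i f e hf.1 hf.2 he he'.le⟩
  by_contra! hn
  have := S.strip_lt i e f he he'.le hf.1 hf.2
    (lt_of_le_of_ne hn (line_ne_line hef he he' hf.1.le hf.2))
  exact lt_asymm h this

theorem strip_succ_lt_iff {i : ℕ} {e f : E} (he : S.left e < i) (he' : i < S.right e)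
    (hf : S.Active (i + 1) f) :
    S.strip (i + 1) f < S.strip (i + 1) e ↔ S.line i f < S.line i e := by
  have hl : S.left f ≤ i := Nat.lt_succ_iff.1 hf.1
  have hr : i < S.right f := hf.2
  rcases eq_or_ne e f with rfl | hef
  · simp
  refine ⟨fun h => ?_, S.strip_succ_lt i f e hl hr he.le he'⟩
  by_contra! hn
  have := S.strip_succ_lt i e f he.le he' hl hr
    (lt_of_le_of_ne hn (line_ne_line hef he he' hl hr.le))
  exact lt_asymm h this

theorem Active.lt_right {i : ℕ} {f : E} (hf : S.Active i f) (h : S.line i f ≠ S.height i) :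
    i < S.right f :=
  lt_of_le_of_ne hf.2 fun he => h (by rw [he]; exact S.line_right f)

theorem Active.left_lt {i : ℕ} {f : E} (hf : S.Active (i + 1) f) (h : S.line i f ≠ S.height i) :
    S.left f < i :=
  lt_of_le_of_ne (Nat.lt_succ_iff.1 hf.1) fun he => h (by rw [← he]; exact S.line_left f)

/-- If the highest arcs satisfying `P` on both sides of vertex `i` avoid that vertex,
then they agree. -/
theorem IsTop.eq_of_line_ne {i : ℕ} {P : E → Prop} {o o' : Option E}
    (ho : S.IsTop i P o) (ho' : S.IsTop (i + 1) P o')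
    (h : ∀ b, o = some b → S.line i b ≠ S.height i)
    (h' : ∀ b, o' = some b → S.line i b ≠ S.height i) : o = o' := by
  cases o with
  | none =>
    cases o' with
    | none => rfl
    | some b =>
      exact absurd ho'.2.1 (ho b ⟨ho'.1.left_lt (h' b rfl), (Nat.lt_of_succ_le ho'.1.2).le⟩)
  | some a =>
    have ha : S.Active (i + 1) a := ⟨ho.1.1.trans (Nat.lt_succ_self i), ho.1.lt_right (h a rfl)⟩
    cases o' with
    | none => exact absurd ho.2.1 (ho' a ha)
    | some b =>
      have hb : S.Active i b := ⟨ho'.1.left_lt (h' b rfl), (Nat.lt_of_succ_le ho'.1.2).le⟩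
      by_contra hne
      have hab : a ≠ b := fun hab => hne (by rw [hab])
      have h1 := ho.2.2 b hb ho'.2.1
      have h2 := ho'.2.2 a ha ho.2.1
      rcases lt_or_gt_of_ne (line_ne_line hab ho.1.1 ha.2 hb.1.le hb.2) with hlt | hlt
      · exact absurd h1 (not_le.2 (S.strip_lt i a b ho.1.1 ho.1.2 hb.1 hb.2 hlt))
      · exact absurd h2 (not_le.2 (S.strip_succ_lt i b a hb.1.le ho'.1.2 ho.1.1.le ha.2 hlt))

variable (S)

/-- The highest arc ending at or passing below vertex `i`, just to the left of it. -/
noncomputable def before [Finite E] (i : ℕ) : Option E :=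
  (exists_isTop (S := S) i fun f => S.line i f ≤ S.height i).choose

/-- The highest arc starting at or passing below vertex `i`, just to the right of it. -/
noncomputable def after [Finite E] (i : ℕ) : Option E :=
  (exists_isTop (S := S) (i + 1) fun f => S.line i f ≤ S.height i).choose

theorem isTop_before [Finite E] (i : ℕ) :
    S.IsTop i (fun f => S.line i f ≤ S.height i) (S.before i) :=
  (exists_isTop (S := S) i fun f => S.line i f ≤ S.height i).choose_spec

theorem isTop_after [Finite E] (i : ℕ) :
    S.IsTop (i + 1) (fun f => S.line i f ≤ S.height i) (S.after i) :=
  (exists_isTop (S := S) (i + 1) fun f => S.line i f ≤ S.height i).choose_spec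

/-- The faces of the drawing, each given by the arcs bounding it from below (`none` for the
part of the unbounded face below everything). -/
def Face [Finite E] (n : ℕ) : Type :=
  Quot fun a b : Option E => ∃ i : Fin n, a = S.before i ∧ b = S.after i

/-- The face immediately above an arc. -/
def face [Finite E] (n : ℕ) (o : Option E) : S.Face n := Quot.mk _ o

variable {S}

theorem face_eq_of_isTop [Finite E] {n i : ℕ} (hi : i < n) {P : E → Prop} {o o' : Option E}
    (hP : (∀ f, S.left f ≤ i → i ≤ S.right f → P f → S.line i f < S.height i) ∨
      ∀ f, S.left f ≤ i → i ≤ S.right f → S.line i f ≤ S.height i → P f)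
    (ho : S.IsTop i P o) (ho' : S.IsTop (i + 1) P o') : S.face n o = S.face n o' := by
  rcases hP with hP | hP
  · congr 1
    refine ho.eq_of_line_ne ho' ?_ ?_
    · rintro b rfl
      exact (hP b ho.1.1.le ho.1.2 ho.2.1).ne
    · rintro b rfl
      exact (hP b (Nat.lt_succ_iff.1 ho'.1.1) (Nat.lt_of_succ_le ho'.1.2).le ho'.2.1).ne
  by_cases hex : ∃ f, S.left f ≤ i ∧ i ≤ S.right f ∧ P f ∧ S.height i < S.line i f
  · obtain ⟨f, hl, hr, hPf, hlt⟩ := hex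
    have hf' : S.Active (i + 1) f := ⟨Nat.lt_succ_of_le hl,
      lt_of_le_of_ne hr fun he => hlt.ne' (by rw [he]; exact S.line_right f)⟩
    have hf : S.Active i f := ⟨hf'.left_lt hlt.ne', hr⟩
    congr 1
    refine ho.eq_of_line_ne ho' ?_ ?_
    · rintro b rfl hb
      exact absurd (ho.2.2 f hf hPf)
        (not_le.2 (S.strip_lt i b f ho.1.1 ho.1.2 hf.1 hf.2 (hb ▸ hlt)))
    · rintro b rfl hb
      exact absurd (ho'.2.2 f hf' hPf) (not_le.2 (S.strip_succ_lt i b f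
        (Nat.lt_succ_iff.1 ho'.1.1) ho'.1.2 hl hf'.2 (hb ▸ hlt)))
  · push Not at hex
    have h1 : S.before i = o := (S.isTop_before i).unique <| ho.congr fun f hf =>
      ⟨hex f hf.1.le hf.2, hP f hf.1.le hf.2⟩
    have h2 : S.after i = o' := (S.isTop_after i).unique <| ho'.congr fun f hf =>
      ⟨hex f (Nat.lt_succ_iff.1 hf.1) (Nat.lt_of_succ_le hf.2).le,
        hP f (Nat.lt_succ_iff.1 hf.1) (Nat.lt_of_succ_le hf.2).le⟩
    exact Quot.sound ⟨⟨i, hi⟩, h1.symm, h2.symm⟩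

/-- The highest arc of every strip bounds the unbounded face. -/
theorem face_top [Finite E] {n k : ℕ} (hk : k ≤ n) {o : Option E}
    (ho : S.IsTop k (fun _ => True) o) : S.face n o = S.face n none := by
  induction k generalizing o with
  | zero =>
    cases o with
    | none => rfl
    | some b => exact absurd ho.1.1 (Nat.not_lt_zero _)
  | succ k ih =>
    obtain ⟨o', ho'⟩ := exists_isTop (S := S) k fun _ => True
    rw [← ih (by omega) ho']
    exact (face_eq_of_isTop (by omega) (Or.inr fun _ _ _ _ => trivial) ho' ho).symm

/-- The face below an arc does not depend on the strip in which it is computed. -/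
theorem face_below [Finite E] {n : ℕ} (hn : ∀ e, S.right e < n) (g : E) {k : ℕ}
    (hk : S.Active k g) {o o' : Option E}
    (ho : S.IsTop k (fun f => S.strip k f < S.strip k g) o)
    (ho' : S.IsTop (S.right g) (fun f => S.strip (S.right g) f < S.strip (S.right g) g) o') :
    S.face n o = S.face n o' := by
  obtain ⟨hl, hr⟩ := hk
  induction hr using Nat.decreasingInduction generalizing o with
  | self => rw [ho.unique ho']
  | of_succ k hr ih =>
    obtain ⟨o₁, ho₁⟩ := exists_isTop (S := S) (k + 1)
      fun f => S.strip (k + 1) f < S.strip (k + 1) g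
    rw [← ih ho₁ (by omega)]
    refine face_eq_of_isTop (P := fun f => S.line k f < S.line k g)
      ((Nat.lt_of_succ_le hr).trans (hn g)) ?_ (ho.congr fun f hf => strip_lt_iff hl hr hf)
      (ho₁.congr fun f hf => strip_succ_lt_iff hl hr hf)
    rcases lt_or_gt_of_ne (S.line_ne k g hl hr) with h | h
    · exact Or.inl fun f _ _ hf => hf.trans h
    · exact Or.inr fun f _ _ hf => hf.trans_lt h

/-- If a single arc `e` forms one of the two sides of a face, then the other side has at least
three arcs. -/
theorem three_le_card_of_singleton (R : ℕ → E → E → Prop)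
    (hR : ∀ k b g, R k b g → S.Active k b ∧ S.Active k g ∧ b ≠ g)
    (huniq : ∀ k b g g', R k b g → R k b g' → g = g')
    (hsimple : ∀ e f, S.left e = S.left f → S.right e = S.right f → e = f)
    (htri : ∀ e f g, S.left e = S.left g → S.right e = S.left f → S.right f ≠ S.right g)
    (e : E) (T : Finset E) (h₁ : ∀ k, S.Active k e → ∃ g ∈ T, R k e g)
    (h₂ : ∀ g ∈ T, ∀ k, S.Active k g → R k e g) : 3 ≤ T.card := by
  classical
  by_contra! hT
  have he := S.left_lt_right e
  obtain ⟨a, haT, ha⟩ := h₁ (S.left e + 1) ⟨by omega, by omega⟩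
  obtain ⟨b, hbT, hb⟩ := h₁ (S.right e) ⟨by omega, le_rfl⟩
  have hae : a ≠ e := (hR _ _ _ ha).2.2.symm
  have hal : S.left a = S.left e := by
    have h := (hR _ _ _ ha).2.1
    by_contra hne
    have h3 := (hR _ _ _ (h₂ a haT (S.left e) ⟨by have := h.1; omega, by have := h.2; omega⟩)).1.1
    omega
  have hbr : S.right b = S.right e := by
    have h := (hR _ _ _ hb).2.1
    by_contra hne
    have h3 := (hR _ _ _ (h₂ b hbT (S.right e + 1)
      ⟨by have := h.1; omega, by have := h.2; omega⟩)).1.2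
    omega
  have hab : a ≠ b := by
    rintro rfl
    exact hae (hsimple a e hal hbr)
  have hTeq : ({a, b} : Finset E) = T :=
    Finset.eq_of_subset_of_card_le (by simp [Finset.insert_subset_iff, haT, hbT])
      (by rw [Finset.card_pair hab]; omega)
  have key : ∀ k, S.left e + 1 ≤ k → k ≤ S.right e → R k e a := by
    intro k hk
    induction k, hk using Nat.le_induction with
    | base => exact fun _ => ha
    | succ k hk ih =>
      intro hk'
      have hka := ih (by omega)
      obtain ⟨g, hgT, hg⟩ := h₁ (k + 1) ⟨by omega, hk'⟩
      rw [← hTeq, Finset.mem_insert, Finset.mem_singleton] at hgT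
      rcases hgT with rfl | rfl
      · exact hg
      exfalso
      have hact := (hR _ _ _ hka).2.1
      have hact' := (hR _ _ _ hg).2.1
      have h1 : S.right a = k := by
        by_contra hne
        exact hab (huniq _ _ _ _
          (h₂ a haT (k + 1) ⟨by have := hact.1; omega, by have := hact.2; omega⟩) hg)
      have h2 : S.left g = k := by
        by_contra hne
        exact hab (huniq _ _ _ _ hka
          (h₂ g hbT k ⟨by have := hact'.1; omega, by have := hact'.2; omega⟩))
      exact htri a g e hal (h1.trans h2.symm) hbr
  exact hab (huniq _ _ _ _ (key (S.right e) he le_rfl) hb)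

/-- A bounded face of a simple triangle-free drawing has at least four sides. -/
theorem four_le_card_sides
    (hsimple : ∀ e f, S.left e = S.left f → S.right e = S.right f → e = f)
    (htri : ∀ e f g, S.left e = S.left g → S.right e = S.left f → S.right f ≠ S.right g)
    (B T : Finset E) (hB : B.Nonempty)
    (h₁ : ∀ b ∈ B, ∀ k, S.Active k b → ∃ g ∈ T, S.Covers k b g)
    (h₂ : ∀ g ∈ T, ∀ k, S.Active k g → ∃ b ∈ B, S.Covers k b g) : 4 ≤ B.card + T.card := by
  have hne : ∀ {k b g}, S.Covers k b g → b ≠ g := by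
    rintro k b g h rfl
    exact lt_irrefl _ h.2.2.1
  have hT : T.Nonempty := by
    obtain ⟨b, hb⟩ := hB
    obtain ⟨g, hg, -⟩ := h₁ b hb (S.right b) ⟨S.left_lt_right b, le_rfl⟩
    exact ⟨g, hg⟩
  have hB0 := hB.card_pos
  have hT0 := hT.card_pos
  rcases Nat.lt_or_ge 1 B.card with hB1 | hB1
  · rcases Nat.lt_or_ge 1 T.card with hT1 | hT1
    · omega
    obtain ⟨e, rfl⟩ := Finset.card_eq_one.1 (le_antisymm hT1 hT0)
    have := three_le_card_of_singleton (S := S) (fun k b g => S.Covers k g b)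
      (fun k b g h => ⟨h.2.1, h.1, (hne h).symm⟩) (fun k b g g' h h' => h.left_unique h')
      hsimple htri e B (fun k hk => h₂ e (by simp) k hk)
      (fun g hg k hk => by simpa using h₁ g hg k hk)
    omega
  · obtain ⟨e, rfl⟩ := Finset.card_eq_one.1 (le_antisymm hB1 hB0)
    have := three_le_card_of_singleton (S := S) S.Covers
      (fun k b g h => ⟨h.1, h.2.1, hne h⟩) (fun k b g g' h h' => h.right_unique h')
      hsimple htri e T (fun k hk => h₁ e (by simp) k hk)
      (fun g hg k hk => by simpa using h₂ g hg k hk)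
    omega

end Sweep

/-- Identifying `n` pairs of elements lowers the number of classes by at most `n`. -/
theorem card_le_card_quot_add {α : Type*} [Finite α] {n : ℕ} (f g : Fin n → α) :
    Nat.card α ≤ Nat.card (Quot fun a b => ∃ i, a = f i ∧ b = g i) + n := by
  classical
  have := Fintype.ofFinite α
  set r : α → α → Prop := fun a b => ∃ i, a = f i ∧ b = g i with hr
  have := Fintype.ofFinite (Quot r)
  let φ : (α → ℚ) →ₗ[ℚ] (Fin n → ℚ) :=
    { toFun := fun u i => u (f i) - u (g i)
      map_add' := fun u v => by ext i; simp; ring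
      map_smul' := fun c u => by ext i; simp; ring }
  let ψ : (Quot r → ℚ) →ₗ[ℚ] (α → ℚ) := LinearMap.funLeft ℚ ℚ (Quot.mk r)
  have hker : LinearMap.ker φ ≤ LinearMap.range ψ := by
    intro u hu
    have hu' : ∀ i, u (f i) = u (g i) := fun i => sub_eq_zero.1 (congrFun hu i)
    refine ⟨Quot.lift u ?_, rfl⟩
    rintro a b ⟨i, rfl, rfl⟩
    exact hu' i
  have h1 := LinearMap.finrank_range_add_finrank_ker φ
  have h2 : Module.finrank ℚ (LinearMap.range φ) ≤ n := by
    simpa using Submodule.finrank_le (LinearMap.range φ)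
  have h3 := (Submodule.finrank_mono hker).trans (LinearMap.finrank_range_le ψ)
  rw [Module.finrank_fintype_fun_eq_card] at h1 h3
  rw [Nat.card_eq_fintype_card, Nat.card_eq_fintype_card]
  omega

/-- A simple triangle-free noncrossing drawing on `n` vertices has at most `2 * n` edges. -/
theorem Sweep.card_le {E : Type} [Fintype E] (S : Sweep E) {n : ℕ} (hn : ∀ e, S.right e < n)
    (hsimple : ∀ e f, S.left e = S.left f → S.right e = S.right f → e = f)
    (htri : ∀ e f g, S.left e = S.left g → S.right e = S.left f → S.right f ≠ S.right g) :
    Fintype.card E ≤ 2 * n := by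
  classical
  have : Finite (S.Face n) := inferInstanceAs (Finite (Quot _))
  have := Fintype.ofFinite (S.Face n)
  have hcard : Fintype.card E + 1 ≤ Fintype.card (S.Face n) + n := by
    have := card_le_card_quot_add (fun i : Fin n => S.before i) (fun i : Fin n => S.after i)
    rw [Nat.card_eq_fintype_card, Fintype.card_option] at this
    rw [← Nat.card_eq_fintype_card (α := S.Face n)]
    exact this
  choose below hbelow using fun g => Sweep.exists_isTop (S := S) (S.right g)
    fun f => S.strip (S.right g) f < S.strip (S.right g) g
  let B : S.Face n → Finset E := fun c => Finset.univ.filter fun e => S.face n (some e) = c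
  let T : S.Face n → Finset E := fun c => Finset.univ.filter fun e => S.face n (below e) = c
  have hB : ∑ c, (B c).card = Fintype.card E :=
    (Finset.card_eq_sum_card_fiberwise fun _ _ => Finset.mem_coe.2 (Finset.mem_univ _)).symm
  have hT : ∑ c, (T c).card = Fintype.card E :=
    (Finset.card_eq_sum_card_fiberwise fun _ _ => Finset.mem_coe.2 (Finset.mem_univ _)).symm
  have hface : ∀ c ∈ Finset.univ.erase (S.face n none), 4 ≤ (B c).card + (T c).card := by
    intro c hc
    have hc : c ≠ S.face n none := Finset.ne_of_mem_erase hc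
    refine Sweep.four_le_card_sides hsimple htri _ _ ?_ ?_ ?_
    · obtain ⟨o, rfl⟩ := Quot.exists_rep c
      cases o with
      | none => exact absurd rfl hc
      | some e => exact ⟨e, Finset.mem_filter.2 ⟨Finset.mem_univ _, rfl⟩⟩
    · intro b hb k hk
      have hb : S.face n (some b) = c := by simpa [B] using hb
      obtain ⟨g, hg⟩ := Sweep.exists_covers hk fun htop =>
        hc (hb.symm.trans (Sweep.face_top (hk.2.trans (hn b).le) htop))
      refine ⟨g, ?_, hg⟩
      have := Sweep.face_below hn g hg.2.1 ((Sweep.covers_iff hg.2.1).1 hg) (hbelow g)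
      simp only [T, Finset.mem_filter, Finset.mem_univ, true_and]
      rw [← this, hb]
    · intro g hg k hk
      have hg : S.face n (below g) = c := by simpa [T] using hg
      obtain ⟨o, ho⟩ := Sweep.exists_isTop (S := S) k fun f => S.strip k f < S.strip k g
      have hoc : S.face n o = c := (Sweep.face_below hn g hk ho (hbelow g)).trans hg
      cases o with
      | none => exact absurd hoc.symm hc
      | some b => exact ⟨b, by simpa [B] using hoc, (Sweep.covers_iff hk).2 ho⟩
  have hsum : (Fintype.card (S.Face n) - 1) * 4 ≤ ∑ c, ((B c).card + (T c).card) := by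
    calc (Fintype.card (S.Face n) - 1) * 4
        = ∑ _c ∈ Finset.univ.erase (S.face n none), 4 := by
          rw [Finset.sum_const, Finset.card_erase_of_mem (Finset.mem_univ _), smul_eq_mul,
            Finset.card_univ]
      _ ≤ ∑ c ∈ Finset.univ.erase (S.face n none), ((B c).card + (T c).card) :=
          Finset.sum_le_sum hface
      _ ≤ _ := Finset.sum_le_sum_of_subset (Finset.erase_subset _ _)
  rw [Finset.sum_add_distrib, hB, hT] at hsum
  omega

/-- A finite set of vertices can be numbered in the order given by an injective function. -/
theorem exists_enumeration {V : Type} (x : V → ℝ) (hx : Function.Injective x) (W : Finset V)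
    (hW : W.Nonempty) : ∃ (idx : V → ℕ) (p : ℕ → V),
      (∀ v ∈ W, idx v < W.card ∧ p (idx v) = v) ∧ (∀ k < W.card, p k ∈ W ∧ idx (p k) = k) ∧
      ∀ v ∈ W, ∀ w ∈ W, (idx v < idx w ↔ x v < x w) := by
  classical
  let : LinearOrder V := LinearOrder.lift' x hx
  obtain ⟨v₀, -⟩ := hW
  let σ : Fin W.card ≃o W := W.orderIsoOfFin rfl
  refine ⟨fun v => if h : v ∈ W then (σ.symm ⟨v, h⟩ : ℕ) else 0,
    fun k => if h : k < W.card then (σ ⟨k, h⟩ : V) else v₀, ?_, ?_, ?_⟩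
  · intro v hv
    simp [hv]
  · intro k hk
    simp [hk]
  · intro v hv w hw
    simp only [hv, hw, dif_pos, Fin.val_fin_lt, OrderIso.lt_iff_lt]
    exact Iff.rfl

/-- The height at abscissa `t` of the line through the points `a` and `b`. -/
noncomputable def lineHeight (a b : ℝ × ℝ) (t : ℝ) : ℝ :=
  a.2 + (t - a.1) * ((b.2 - a.2) / (b.1 - a.1))

theorem lineHeight_left (a b : ℝ × ℝ) : lineHeight a b a.1 = a.2 := by simp [lineHeight]

theorem lineHeight_right {a b : ℝ × ℝ} (h : a.1 < b.1) : lineHeight a b b.1 = b.2 := by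
  have : b.1 - a.1 ≠ 0 := by linarith
  simp only [lineHeight]
  field_simp
  ring

theorem continuous_lineHeight (a b : ℝ × ℝ) : Continuous (lineHeight a b) := by
  unfold lineHeight
  fun_prop

theorem mem_seg_lineHeight {a b : ℝ × ℝ} (h : a.1 < b.1) {t : ℝ} (ha : a.1 ≤ t) (hb : t ≤ b.1) :
    (t, lineHeight a b t) ∈ seg a b := by
  have h0 : 0 < b.1 - a.1 := by linarith
  rw [seg, segment_eq_image]
  refine ⟨(t - a.1) / (b.1 - a.1), ⟨div_nonneg (by linarith) h0.le,
    (div_le_one h0).2 (by linarith)⟩, ?_⟩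
  ext
  · simp only [Prod.fst_add, Prod.smul_fst, smul_eq_mul]
    field_simp
    ring
  · simp only [Prod.snd_add, Prod.smul_snd, smul_eq_mul, lineHeight]
    field_simp
    ring

namespace PlaneEmb

variable {V : Type} {G : SimpleGraph V} (P : PlaneEmb G)

/-- Two edges which cross or touch do so at a common endpoint. -/
theorem exists_common_endpoint {e f : V × V} (he : G.Adj e.1 e.2) (hf : G.Adj f.1 f.2)
    (hex : (P.pos e.1).1 < (P.pos e.2).1) (hfx : (P.pos f.1).1 < (P.pos f.2).1) (hef : e ≠ f)
    {t : ℝ} (he₁ : (P.pos e.1).1 ≤ t) (he₂ : t ≤ (P.pos e.2).1)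
    (hf₁ : (P.pos f.1).1 ≤ t) (hf₂ : t ≤ (P.pos f.2).1)
    (h : lineHeight (P.pos e.1) (P.pos e.2) t = lineHeight (P.pos f.1) (P.pos f.2) t) :
    ∃ v, (v = e.1 ∨ v = e.2) ∧ P.pos v = (t, lineHeight (P.pos e.1) (P.pos e.2) t) := by
  have hne : s(e.1, e.2) ≠ s(f.1, f.2) := by
    intro hs
    rcases Sym2.eq_iff.1 hs with ⟨h1, h2⟩ | ⟨h1, h2⟩
    · exact hef (Prod.ext h1 h2)
    · rw [h1, h2] at hex
      exact lt_asymm hex hfx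
  have hmem := P.edges_meet he hf hne ⟨mem_seg_lineHeight hex he₁ he₂,
    h ▸ mem_seg_lineHeight hfx hf₁ hf₂⟩
  rcases hmem.1 with h1 | h1
  · exact ⟨e.1, Or.inl rfl, h1.symm⟩
  · exact ⟨e.2, Or.inr rfl, h1.symm⟩

/-- Between two abscissas at which two edges have different vertical orders there is an endpoint. -/
theorem exists_endpoint_of_swap {e f : V × V} (he : G.Adj e.1 e.2) (hf : G.Adj f.1 f.2)
    (hex : (P.pos e.1).1 < (P.pos e.2).1) (hfx : (P.pos f.1).1 < (P.pos f.2).1)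
    {s t : ℝ} (hes : s ∈ Icc (P.pos e.1).1 (P.pos e.2).1) (het : t ∈ Icc (P.pos e.1).1 (P.pos e.2).1)
    (hfs : s ∈ Icc (P.pos f.1).1 (P.pos f.2).1) (hft : t ∈ Icc (P.pos f.1).1 (P.pos f.2).1)
    (hs : lineHeight (P.pos e.1) (P.pos e.2) s < lineHeight (P.pos f.1) (P.pos f.2) s)
    (ht : lineHeight (P.pos f.1) (P.pos f.2) t ≤ lineHeight (P.pos e.1) (P.pos e.2) t) :
    ∃ v, (v = e.1 ∨ v = e.2) ∧ (P.pos v).1 ∈ uIcc s t ∧ (P.pos v).1 ≠ s := by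
  set d : ℝ → ℝ := fun u =>
    lineHeight (P.pos f.1) (P.pos f.2) u - lineHeight (P.pos e.1) (P.pos e.2) u with hd
  have hcont : ContinuousOn d (uIcc s t) :=
    ((continuous_lineHeight _ _).sub (continuous_lineHeight _ _)).continuousOn
  obtain ⟨u, hu, hu0⟩ := intermediate_value_uIcc hcont
    (mem_uIcc.2 (Or.inr ⟨sub_nonpos.2 ht, (sub_pos.2 hs).le⟩) : (0 : ℝ) ∈ uIcc (d s) (d t))
  have hue : u ∈ Icc (P.pos e.1).1 (P.pos e.2).1 := uIcc_subset_Icc hes het hu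
  have huf : u ∈ Icc (P.pos f.1).1 (P.pos f.2).1 := uIcc_subset_Icc hfs hft hu
  have hef : e ≠ f := by
    rintro rfl
    exact lt_irrefl _ hs
  obtain ⟨v, hv, hpos⟩ := P.exists_common_endpoint he hf hex hfx hef hue.1 hue.2 huf.1 huf.2
    (sub_eq_zero.1 hu0).symm
  refine ⟨v, hv, by rw [hpos]; exact hu, ?_⟩
  rw [hpos]
  rintro rfl
  exact hs.ne (sub_eq_zero.1 hu0).symm

/-- A set of edges of a triangle-free plane graph has at most twice as many elements as any set
of vertices containing all their endpoints. -/
theorem card_edges_le (hx : Function.Injective fun v => (P.pos v).1)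
    (hC3 : ∀ a b c, G.Adj a b → G.Adj b c → ¬ G.Adj a c) (F : Finset (V × V)) (W : Finset V)
    (hF : ∀ e ∈ F, G.Adj e.1 e.2 ∧ (P.pos e.1).1 < (P.pos e.2).1)
    (hW : ∀ e ∈ F, e.1 ∈ W ∧ e.2 ∈ W) : F.card ≤ 2 * W.card := by
  classical
  rcases F.eq_empty_or_nonempty with rfl | ⟨e₀, he₀⟩
  · simp
  obtain ⟨idx, p, hidx, hp, hlt⟩ := exists_enumeration _ hx W ⟨e₀.1, (hW e₀ he₀).1⟩
  let x : V → ℝ := fun v => (P.pos v).1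
  let l : F → ℕ := fun e => idx e.1.1
  let r : F → ℕ := fun e => idx e.1.2
  let h : F → ℝ → ℝ := fun e => lineHeight (P.pos e.1.1) (P.pos e.1.2)
  let m : ℕ → ℝ := fun k => (x (p (k - 1)) + x (p k)) / 2
  have hadj : ∀ e : F, G.Adj e.1.1 e.1.2 := fun e => (hF e.1 e.2).1
  have hex : ∀ e : F, x e.1.1 < x e.1.2 := fun e => (hF e.1 e.2).2
  have hlW : ∀ e : F, e.1.1 ∈ W := fun e => (hW e.1 e.2).1
  have hrW : ∀ e : F, e.1.2 ∈ W := fun e => (hW e.1 e.2).2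
  have hln : ∀ e, l e < W.card := fun e => (hidx _ (hlW e)).1
  have hrn : ∀ e, r e < W.card := fun e => (hidx _ (hrW e)).1
  have hpl : ∀ e, p (l e) = e.1.1 := fun e => (hidx _ (hlW e)).2
  have hpr : ∀ e, p (r e) = e.1.2 := fun e => (hidx _ (hrW e)).2
  have hxlt : ∀ {i j}, j < W.card → i < j → x (p i) < x (p j) := fun {i j} hj hij => by
    rw [← hlt _ (hp i (hij.trans hj)).1 _ (hp j hj).1, (hp i (hij.trans hj)).2, (hp j hj).2]
    exact hij
  have hxle : ∀ {i j}, j < W.card → i ≤ j → x (p i) ≤ x (p j) := fun {i j} hj hij => by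
    rcases hij.eq_or_lt with rfl | hij
    · exact le_rfl
    · exact (hxlt hj hij).le
  have hspan : ∀ (e : F) {i}, l e ≤ i → i ≤ r e → x (p i) ∈ Icc (x e.1.1) (x e.1.2) :=
    fun e i hi hi' => ⟨hpl e ▸ hxle (hi'.trans_lt (hrn e)) hi, hpr e ▸ hxle (hrn e) hi'⟩
  have hmid : ∀ {k}, 0 < k → k < W.card → x (p (k - 1)) < m k ∧ m k < x (p k) :=
    fun {k} hk hk' => by
      have := hxlt hk' (show k - 1 < k by omega)
      constructor <;> simp only [m] <;> linarith
  have hspan_mid : ∀ (e : F) {k}, l e < k → k ≤ r e → m k ∈ Icc (x e.1.1) (x e.1.2) :=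
    fun e k hk hk' => by
      have h1 := hmid (by omega) (hk'.trans_lt (hrn e))
      have h2 := hspan e (show l e ≤ k - 1 by omega) (by omega)
      have h3 := hspan e hk.le hk'
      exact ⟨h2.1.trans h1.1.le, h1.2.le.trans h3.2⟩
  have hgap : ∀ {k v}, 0 < k → k < W.card → v ∈ W → x (p (k - 1)) < x v → ¬ x v < x (p k) :=
    fun {k v} hk hk' hv h1 h2 => by
      rw [← hlt _ (hp _ (by omega)).1 _ hv, (hp _ (by omega)).2] at h1
      rw [← hlt _ hv _ (hp _ hk').1, (hp _ hk').2] at h2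
      omega
  have hend : ∀ (e : F) {v}, v = e.1.1 ∨ v = e.1.2 → v ∈ W := by
    rintro e v (rfl | rfl)
    exacts [hlW e, hrW e]
  let S : Sweep F :=
    { left := l
      right := r
      height := fun i => (P.pos (p i)).2
      line := fun i e => h e (x (p i))
      strip := fun k e => h e (m k)
      left_lt_right := fun e => (hlt _ (hlW e) _ (hrW e)).2 (hex e)
      line_left := fun e => by
        simp only [hpl]
        exact lineHeight_left _ _
      line_right := fun e => by
        simp only [hpr]
        exact lineHeight_right (hex e)
      line_ne := fun i e hl hr heq => by
        have hs := hspan e hl.le hr.le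
        have hi := (hp i (hr.trans (hrn e))).2
        refine P.vertex_off (hadj e) (v := p i) ?_ ?_ ?_
        · intro h1
          have : idx (p i) = l e := congrArg idx h1
          omega
        · intro h1
          have : idx (p i) = r e := congrArg idx h1
          omega
        · have := mem_seg_lineHeight (hex e) hs.1 hs.2
          rwa [show lineHeight _ _ _ = _ from heq] at this
      line_eq := fun i e f hef hel her hfl hfr heq => by
        have hs := hspan e hel her
        have hs' := hspan f hfl hfr
        obtain ⟨v, -, hpos⟩ := P.exists_common_endpoint (hadj e) (hadj f) (hex e) (hex f)
          (fun h => hef (Subtype.ext h)) hs.1 hs.2 hs'.1 hs'.2 heq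
        have hv : v = p i := hx (show (P.pos v).1 = _ by rw [hpos])
        rw [← hv, hpos, hv]
      strip_inj := fun k e f hel her hfl hfr heq => by
        by_contra hef
        have hs := hspan_mid e hel her
        have hs' := hspan_mid f hfl hfr
        obtain ⟨v, hv, hpos⟩ := P.exists_common_endpoint (hadj e) (hadj f) (hex e) (hex f)
          (fun h => hef (Subtype.ext h)) hs.1 hs.2 hs'.1 hs'.2 heq
        have hvx : x v = m k := congrArg Prod.fst hpos
        have hk := hmid (by omega) (her.trans_lt (hrn e))
        rw [← hvx] at hk
        exact hgap (by omega) (her.trans_lt (hrn e)) (hend e hv) hk.1 hk.2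
      strip_lt := fun i e f hel her hfl hfr hlt => by
        by_contra! hle
        obtain ⟨v, hv, hu, hne⟩ := P.exists_endpoint_of_swap (hadj e) (hadj f) (hex e) (hex f)
          (hspan e hel.le her) (hspan_mid e hel her) (hspan f hfl.le hfr)
          (hspan_mid f hfl hfr) hlt hle
        have hk := hmid (by omega) (her.trans_lt (hrn e))
        rw [uIcc_of_ge hk.2.le] at hu
        exact hgap (by omega) (her.trans_lt (hrn e)) (hend e hv) (hk.1.trans_le hu.1)
          (lt_of_le_of_ne hu.2 hne)
      strip_succ_lt := fun i e f hel her hfl hfr hlt => by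
        by_contra! hle
        obtain ⟨v, hv, hu, hne⟩ := P.exists_endpoint_of_swap (hadj e) (hadj f) (hex e) (hex f)
          (hspan e hel her.le) (hspan_mid e (Nat.lt_succ_of_le hel) her) (hspan f hfl hfr.le)
          (hspan_mid f (Nat.lt_succ_of_le hfl) hfr) hlt hle
        have hi : i + 1 < W.card := (Nat.succ_le_of_lt her).trans_lt (hrn e)
        have hk : x (p i) < m (i + 1) ∧ m (i + 1) < x (p (i + 1)) := hmid (Nat.succ_pos i) hi
        rw [uIcc_of_le hk.1.le] at hu
        exact hgap (Nat.succ_pos i) hi (hend e hv) (lt_of_le_of_ne hu.1 hne.symm)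
          (hu.2.trans_lt hk.2) }
  have hinj : ∀ {v w}, v ∈ W → w ∈ W → idx v = idx w → v = w := fun {v w} hv hw h => by
    rw [← (hidx v hv).2, h, (hidx w hw).2]
  have := S.card_le hrn
    (fun e f h1 h2 => Subtype.ext (Prod.ext (hinj (hlW e) (hlW f) h1) (hinj (hrW e) (hrW f) h2)))
    (fun e f g h1 h2 h3 => by
      have h1 : e.1.1 = g.1.1 := hinj (hlW e) (hlW g) h1
      have h2 : e.1.2 = f.1.1 := hinj (hrW e) (hlW f) h2
      have h3 : f.1.2 = g.1.2 := hinj (hrW f) (hrW g) h3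
      refine hC3 e.1.1 e.1.2 f.1.2 (hadj e) (h2 ▸ hadj f) ?_
      rw [h1, h3]
      exact hadj g)
  simpa using this

/-- The image of a plane embedding under a linear automorphism of the plane. -/
def map (φ : (ℝ × ℝ) ≃ₗ[ℝ] ℝ × ℝ) : PlaneEmb G where
  pos v := φ (P.pos v)
  inj := φ.injective.comp P.inj
  edges_meet a b c d hab hcd hne := by
    have hseg : ∀ u w : ℝ × ℝ, seg (φ u) (φ w) = φ '' seg u w := fun u w =>
      (image_segment ℝ φ.toLinearMap.toAffineMap u w).symm
    rw [hseg, hseg, ← image_inter φ.injective, ← image_pair φ, ← image_pair φ,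
      ← image_inter φ.injective]
    exact image_mono (P.edges_meet hab hcd hne)
  vertex_off a b v hab ha hb := by
    have hseg : seg (φ (P.pos a)) (φ (P.pos b)) = φ '' seg (P.pos a) (P.pos b) :=
      (image_segment ℝ φ.toLinearMap.toAffineMap _ _).symm
    rw [hseg, φ.injective.mem_set_image]
    exact P.vertex_off hab ha hb

/-- After a shear, no two vertices have the same abscissa. -/
theorem exists_injective_fst [Finite V] (P : PlaneEmb G) :
    ∃ Q : PlaneEmb G, Function.Injective fun v => (Q.pos v).1 := by
  let bad : V × V → ℝ := fun q =>
    ((P.pos q.2).1 - (P.pos q.1).1) / ((P.pos q.1).2 - (P.pos q.2).2)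
  obtain ⟨s, hs⟩ := (finite_range bad).exists_notMem
  let φ : (ℝ × ℝ) ≃ₗ[ℝ] ℝ × ℝ :=
    { toFun := fun q => (q.1 + s * q.2, q.2)
      invFun := fun q => (q.1 - s * q.2, q.2)
      map_add' := fun u v => by ext <;> simp; ring
      map_smul' := fun c u => by ext <;> simp; ring
      left_inv := fun u => by simp
      right_inv := fun u => by simp }
  refine ⟨P.map φ, fun u v huv => P.inj ?_⟩
  have huv : (P.pos u).1 + s * (P.pos u).2 = (P.pos v).1 + s * (P.pos v).2 := huv
  by_cases h2 : (P.pos u).2 = (P.pos v).2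
  · rw [h2] at huv
    exact Prod.ext (by linarith) h2
  · refine absurd ⟨(u, v), ?_⟩ hs
    rw [div_eq_iff (sub_ne_zero.2 h2)]
    linarith

end PlaneEmb

/-- If the edges of a graph can be assigned injectively to the elements of `V × Bool`, each to one
of its endpoints, then the graph is `(3,1)`-choosable. -/
theorem choosable_of_orientation {V : Type} (G : SimpleGraph V) {E : Set (V × V)}
    (hE : ∀ ⦃u v⦄, G.Adj u v → (u, v) ∈ E ∨ (v, u) ∈ E) (hadj : ∀ e ∈ E, G.Adj e.1 e.2)
    (f : E → V × Bool) (hf : Function.Injective f)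
    (hend : ∀ e : E, (f e).1 = e.1.1 ∨ (f e).1 = e.1.2) : Choosable G 3 1 := by
  classical
  intro L hL hsep
  let C : V × Bool → Finset ℕ := fun q =>
    if h : ∃ e, f e = q then L h.choose.1.1 ∩ L h.choose.1.2 else ∅
  have hC : ∀ e : E, C (f e) = L e.1.1 ∩ L e.1.2 := fun e => by
    have h : ∃ e', f e' = f e := ⟨e, rfl⟩
    simp only [C, dif_pos h, hf h.choose_spec]
  have hC1 : ∀ q, (C q).card ≤ 1 := fun q => by
    by_cases h : ∃ e, f e = q
    · obtain ⟨e, rfl⟩ := h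
      rw [hC]
      exact hsep (hadj _ e.2)
    · simp only [C, dif_neg h, Finset.card_empty, zero_le]
  have hex : ∀ v, ∃ c ∈ L v, c ∉ C (v, true) ∪ C (v, false) := fun v =>
    Finset.exists_mem_notMem_of_card_lt_card <|
      calc (C (v, true) ∪ C (v, false)).card ≤ (C (v, true)).card + (C (v, false)).card :=
            Finset.card_union_le _ _
        _ < 3 := by have := hC1 (v, true); have := hC1 (v, false); omega
        _ ≤ (L v).card := hL v
  choose φ hφ hφC using hex
  have hφC' : ∀ q : V × Bool, φ q.1 ∉ C q := by
    rintro ⟨v, b⟩ h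
    cases b with
    | true => exact hφC v (Finset.mem_union_left _ h)
    | false => exact hφC v (Finset.mem_union_right _ h)
  have key : ∀ e : E, φ e.1.1 ≠ φ e.1.2 := fun e heq => by
    refine hφC' (f e) ?_
    rw [hC, Finset.mem_inter]
    rcases hend e with h | h
    · rw [h]
      exact ⟨hφ _, heq ▸ hφ _⟩
    · rw [h]
      exact ⟨heq ▸ hφ _, hφ _⟩
  refine ⟨φ, hφ, fun u v huv => ?_⟩
  rcases hE huv with h | h
  · exact key ⟨_, h⟩
  · exact (key ⟨_, h⟩).symm

/-- **Theorem (Kratochvíl–Tuza–Voigt).**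
Every planar graph with no cycle of length 3 is `(3,1)`-choosable. -/
theorem triangleFree_planar_choosable_3_1 {V : Type} [Fintype V]
    (G : SimpleGraph V) (hplanar : IsPlanar G) (hC3 : ¬ HasCycleLen G 3) :
    Choosable G 3 1 := by
  classical
  have htri : ∀ a b c, G.Adj a b → G.Adj b c → ¬ G.Adj a c := fun a b c hab hbc hac => by
    obtain ⟨v, w, hw⟩ := (SimpleGraph.is3Clique_iff_exists_cycle_length_three).1
      ⟨{a, b, c}, SimpleGraph.is3Clique_triple_iff.2 ⟨hab, hac, hbc⟩⟩
    exact hC3 ⟨v, w, hw⟩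
  obtain ⟨P₀⟩ := hplanar
  obtain ⟨P, hx⟩ := P₀.exists_injective_fst
  let E : Set (V × V) := {e | G.Adj e.1 e.2 ∧ (P.pos e.1).1 < (P.pos e.2).1}
  let t : E → Finset (V × Bool) := fun e => ({e.1.1, e.1.2} : Finset V) ×ˢ Finset.univ
  obtain ⟨f, hf, hft⟩ := (Finset.all_card_le_biUnion_card_iff_exists_injective t).1 fun s => by
    have hW : s.biUnion t =
        (s.biUnion fun e => ({e.1.1, e.1.2} : Finset V)) ×ˢ (Finset.univ : Finset Bool) := by
      ext ⟨v, b⟩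
      simp [t]
    have := P.card_edges_le hx htri (s.map (Function.Embedding.subtype _))
      (s.biUnion fun e => ({e.1.1, e.1.2} : Finset V))
      (fun e he => by
        obtain ⟨e, -, rfl⟩ := Finset.mem_map.1 he
        exact e.2)
      (fun e he => by
        obtain ⟨e, hes, rfl⟩ := Finset.mem_map.1 he
        exact ⟨Finset.mem_biUnion.2 ⟨e, hes, by simp⟩, Finset.mem_biUnion.2 ⟨e, hes, by simp⟩⟩)
    rw [hW, Finset.card_product, Finset.card_univ, Fintype.card_bool, mul_comm]
    rwa [Finset.card_map] at this
  refine choosable_of_orientation G (E := E) (fun u v huv => ?_) (fun e he => he.1) f hf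
    fun e => ?_
  · rcases lt_or_gt_of_ne (hx.ne huv.ne) with h | h
    · exact Or.inl ⟨huv, h⟩
    · exact Or.inr ⟨huv.symm, h⟩
  · simpa [t] using hft e

end ChoosSep
end

section
/- Every planar graph with no cycle of length 4 is (3,1)-choosable. -/
open Set

namespace ChoosSep

/-- Twice the signed area of the triangle `p q r`. -/
noncomputable def orient (p q r : ℝ × ℝ) : ℝ :=
  (q.1 - p.1) * (r.2 - p.2) - (q.2 - p.2) * (r.1 - p.1)

theorem orient_add (p q r w : ℝ × ℝ) :
    orient p q w + orient q r w + orient r p w = orient p q r := by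
  simp only [orient]; ring

theorem orient_rotate (p q r : ℝ × ℝ) : orient q r p = orient p q r := by
  simp only [orient]; ring

theorem orient_swap (p q r : ℝ × ℝ) : orient p r q = -orient p q r := by
  simp only [orient]; ring

theorem orient_right (p q : ℝ × ℝ) : orient p q q = 0 := by
  simp only [orient]; ring

theorem orient_left (p q : ℝ × ℝ) : orient p q p = 0 := by
  simp only [orient]; ring

theorem mem_seg_iff {x y z : ℝ × ℝ} :
    z ∈ seg x y ↔ ∃ l : ℝ, 0 ≤ l ∧ l ≤ 1 ∧ z.1 = x.1 + l * (y.1 - x.1) ∧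
      z.2 = x.2 + l * (y.2 - x.2) := by
  rw [seg, segment_eq_image']
  constructor
  · rintro ⟨l, ⟨h0, h1⟩, rfl⟩
    exact ⟨l, h0, h1, by simp, by simp⟩
  · rintro ⟨l, h0, h1, h2, h3⟩
    exact ⟨l, ⟨h0, h1⟩, Prod.ext (by simp [h2]) (by simp [h3])⟩

theorem exists_orient_of_mem_seg {x y z : ℝ × ℝ} (h : z ∈ seg x y) :
    ∃ l : ℝ, 0 ≤ l ∧ l ≤ 1 ∧ (l = 0 → z = x) ∧ (l = 1 → z = y) ∧
      ∀ p q, orient p q z = (1 - l) * orient p q x + l * orient p q y := by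
  obtain ⟨l, h0, h1, h2, h3⟩ := mem_seg_iff.1 h
  refine ⟨l, h0, h1, ?_, ?_, ?_⟩
  · rintro rfl; exact Prod.ext (by simp [h2]) (by simp [h3])
  · rintro rfl; exact Prod.ext (by simp [h2]) (by simp [h3])
  · intro p q; simp only [orient, h2, h3]; ring

theorem mem_seg_of_orient {v a b y : ℝ × ℝ} (hD : 0 < orient v a b)
    (h0 : orient v a y = 0) (h1 : 0 ≤ orient b v y) (h2 : 0 ≤ orient a b y) : y ∈ seg v a := by
  have hs := orient_add v a b y
  have e1 : orient v a b * (y.1 - v.1) = orient b v y * (a.1 - v.1) + orient v a y * (b.1 - v.1) := by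
    simp only [orient]; ring
  have e2 : orient v a b * (y.2 - v.2) = orient b v y * (a.2 - v.2) + orient v a y * (b.2 - v.2) := by
    simp only [orient]; ring
  refine mem_seg_iff.2 ⟨orient b v y / orient v a b, by positivity,
    (div_le_one hD).2 (by linarith), ?_, ?_⟩ <;>
  · field_simp
    simp only [h0] at e1 e2
    linarith

/-- `p` draws `H` in the plane with straight edges and without crossings. -/
structure IsPlaneDrawing {V : Type} (p : V → ℝ × ℝ) (H : SimpleGraph V) : Prop where
  inj : Function.Injective p
  edges_meet : ∀ ⦃a b c d : V⦄, H.Adj a b → H.Adj c d → s(a, b) ≠ s(c, d) →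
    seg (p a) (p b) ∩ seg (p c) (p d) ⊆ ({p a, p b} ∩ {p c, p d} : Set (ℝ × ℝ))
  vertex_off : ∀ ⦃a b v : V⦄, H.Adj a b → v ≠ a → v ≠ b → p v ∉ seg (p a) (p b)

theorem seg_comm (x y : ℝ × ℝ) : seg x y = seg y x := segment_symm ℝ x y

section Drawing

variable {V : Type} {p : V → ℝ × ℝ} {H : SimpleGraph V}

/-- In a maximal drawing, the segment between nonadjacent vertices is obstructed. -/
theorem exists_obstruction (hmax : Maximal (IsPlaneDrawing p) H) {u w : V} (huw : u ≠ w)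
    (hadj : ¬ H.Adj u w) :
    (∃ x, x ≠ u ∧ x ≠ w ∧ p x ∈ seg (p u) (p w)) ∨
    ∃ c d z, H.Adj c d ∧ z ∈ seg (p c) (p d) ∧ z ∈ seg (p u) (p w) ∧ z ≠ p u ∧ z ≠ p w := by
  by_contra! hno
  obtain ⟨hv, he⟩ := hno
  have hP := hmax.prop
  have hcross : ∀ ⦃c d : V⦄, H.Adj c d →
      seg (p c) (p d) ∩ seg (p u) (p w) ⊆ ({p c, p d} ∩ {p u, p w} : Set (ℝ × ℝ)) := by
    rintro c d hcd z ⟨hz1, hz2⟩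
    have hz : z = p u ∨ z = p w := by
      by_contra! h
      exact h.2 (he c d z hcd hz1 hz2 h.1)
    refine ⟨?_, hz⟩
    rcases hz with rfl | rfl
    · by_contra h
      simp only [mem_insert_iff, mem_singleton_iff, not_or] at h
      exact hP.vertex_off hcd (fun e => h.1 (e ▸ rfl)) (fun e => h.2 (e ▸ rfl)) hz1
    · by_contra h
      simp only [mem_insert_iff, mem_singleton_iff, not_or] at h
      exact hP.vertex_off hcd (fun e => h.1 (e ▸ rfl)) (fun e => h.2 (e ▸ rfl)) hz1
  have key : ∀ {a b}, (H ⊔ SimpleGraph.edge u w).Adj a b →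
      H.Adj a b ∨ (a = u ∧ b = w) ∨ (a = w ∧ b = u) := by
    intro a b h
    rw [SimpleGraph.sup_adj, SimpleGraph.edge_adj] at h
    tauto
  have hnew : IsPlaneDrawing p (H ⊔ SimpleGraph.edge u w) := by
    refine ⟨hP.inj, ?_, ?_⟩
    · intro a b c d hab hcd hne
      rcases key hab with h1 | ⟨rfl, rfl⟩ | ⟨rfl, rfl⟩ <;>
        rcases key hcd with h2 | ⟨rfl, rfl⟩ | ⟨rfl, rfl⟩
      · exact hP.edges_meet h1 h2 hne
      · exact hcross h1
      · rw [seg_comm (p c), pair_comm (p c)]; exact hcross h1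
      · rw [inter_comm, inter_comm {_, _}]; exact hcross h2
      · exact absurd rfl hne
      · exact absurd Sym2.eq_swap hne
      · rw [inter_comm, inter_comm {_, _}, seg_comm (p a), pair_comm (p a)]; exact hcross h2
      · exact absurd Sym2.eq_swap hne
      · exact absurd rfl hne
    · intro a b v hab hva hvb
      rcases key hab with h1 | ⟨rfl, rfl⟩ | ⟨rfl, rfl⟩
      · exact hP.vertex_off h1 hva hvb
      · exact hv v hva hvb
      · rw [seg_comm]; exact hv v hvb hva
  have hle := hmax.le_of_ge hnew le_sup_left
  exact hadj (hle (by rw [SimpleGraph.sup_adj, SimpleGraph.edge_adj]; tauto))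

/-- A point of the segment from inside the triangle `v a b` to a point outside the cone at `v`,
but on the inner side of `a b`, where it leaves the cone. -/
theorem exists_exit {v a b z c : ℝ × ℝ} (hα : 0 < orient b v z) (hβ : 0 < orient v a z)
    (hγ : 0 ≤ orient a b z) (hγc : 0 ≤ orient a b c) (hc : orient v a c < 0) :
    ∃ y ∈ seg z c, 0 ≤ orient a b y ∧
      (orient v a y = 0 ∧ 0 ≤ orient b v y ∨ orient b v y = 0 ∧ 0 ≤ orient v a y) := by
  have point : ∀ l : ℝ, 0 ≤ l → l ≤ 1 → ∃ y ∈ seg z c,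
      ∀ q r, orient q r y = (1 - l) * orient q r z + l * orient q r c := by
    intro l h0 h1
    refine ⟨(z.1 + l * (c.1 - z.1), z.2 + l * (c.2 - z.2)),
      mem_seg_iff.2 ⟨l, h0, h1, rfl, rfl⟩, fun q r => ?_⟩
    simp only [orient]; ring
  have hd : 0 < orient v a z - orient v a c := by linarith
  obtain ⟨y, hy, hl⟩ := point (orient v a z / (orient v a z - orient v a c)) (by positivity)
    ((div_le_one hd).2 (by linarith))
  have hl0 : 0 ≤ orient v a z / (orient v a z - orient v a c) := by positivity
  have hl1 : orient v a z / (orient v a z - orient v a c) ≤ 1 := (div_le_one hd).2 (by linarith)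
  by_cases h : 0 ≤ orient b v y
  · refine ⟨y, hy, ?_, Or.inl ⟨?_, h⟩⟩
    · rw [hl]; nlinarith
    · rw [hl]; field_simp; ring
  · push Not at h
    have hy0 : orient v a y = 0 := by rw [hl]; field_simp; ring
    have hbc : orient b v c < 0 := by
      rw [hl] at h
      by_contra! hge
      nlinarith
    have hd' : 0 < orient b v z - orient b v c := by linarith
    obtain ⟨x, hx, hk⟩ := point (orient b v z / (orient b v z - orient b v c)) (by positivity)
      ((div_le_one hd').2 (by linarith))
    have hk0 : 0 ≤ orient b v z / (orient b v z - orient b v c) := by positivity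
    have hk1 : orient b v z / (orient b v z - orient b v c) ≤ 1 :=
      (div_le_one hd').2 (by linarith)
    refine ⟨x, hx, ?_, Or.inr ⟨?_, ?_⟩⟩
    · rw [hk]; nlinarith
    · rw [hk]; field_simp; ring
    · rw [hl] at h
      rw [hk]
      have e1 : (1 - orient v a z / (orient v a z - orient v a c)) * orient b v z +
          orient v a z / (orient v a z - orient v a c) * orient b v c =
          (orient v a z * orient b v c - orient v a c * orient b v z) /
            (orient v a z - orient v a c) := by
        field_simp; ring
      have e2 : (1 - orient b v z / (orient b v z - orient b v c)) * orient v a z +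
          orient b v z / (orient b v z - orient b v c) * orient v a c =
          -(orient v a z * orient b v c - orient v a c * orient b v z) /
            (orient b v z - orient b v c) := by
        field_simp; ring
      rw [e1, div_neg_iff] at h
      rw [e2]
      have : orient v a z * orient b v c - orient v a c * orient b v z < 0 := by
        rcases h with h | h <;> linarith
      apply div_nonneg <;> linarith

theorem exists_exit' {v a b z c : ℝ × ℝ} (hα : 0 < orient b v z) (hβ : 0 < orient v a z)
    (hγ : 0 ≤ orient a b z) (hγc : 0 ≤ orient a b c) (hc : ¬ (0 ≤ orient b v c ∧ 0 ≤ orient v a c)) :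
    ∃ y ∈ seg z c, 0 ≤ orient a b y ∧
      (orient v a y = 0 ∧ 0 ≤ orient b v y ∨ orient b v y = 0 ∧ 0 ≤ orient v a y) := by
  rcases lt_or_ge (orient v a c) 0 with h | h
  · exact exists_exit hα hβ hγ hγc h
  have hbc : orient b v c < 0 := by
    by_contra! h'
    exact hc ⟨h', h⟩
  have hr : ∀ x y z : ℝ × ℝ, orient x.swap y.swap z.swap = orient y x z := by
    intro x y z; simp only [orient, Prod.fst_swap, Prod.snd_swap]; ring
  obtain ⟨y, hy, h1, h2⟩ := exists_exit (v := v.swap) (a := b.swap) (b := a.swap) (z := z.swap)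
    (c := c.swap) (by rwa [hr]) (by rwa [hr]) (by rwa [hr]) (by rwa [hr]) (by rwa [hr])
  have hr' : ∀ x z : ℝ × ℝ, orient x.swap z.swap y = orient z x y.swap := by
    intro x z; simpa using hr x z y.swap
  refine ⟨y.swap, ?_, ?_, ?_⟩
  · obtain ⟨l, h0, h1, h2, h3⟩ := mem_seg_iff.1 hy
    exact mem_seg_iff.2 ⟨l, h0, h1, h3, h2⟩
  · rwa [hr'] at h1
  · rw [hr', hr'] at h2
    tauto

/-- The edges `v a` and `v b` bound a convex cone at `v` that contains no further edge at `v`. -/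
structure Wedge (p : V → ℝ × ℝ) (H : SimpleGraph V) (v a b : V) : Prop where
  left : H.Adj v a
  right : H.Adj v b
  pos : 0 < orient (p v) (p a) (p b)
  empty : ∀ w, H.Adj v w → 0 < orient (p v) (p a) (p w) → orient (p b) (p v) (p w) ≤ 0

theorem Wedge.ends_ne {v a b c d : V} (hw : Wedge p H v a b) (hcd : H.Adj c d) {z : ℝ × ℝ}
    (hz : z ∈ seg (p c) (p d)) (hα : 0 < orient (p b) (p v) z) (hβ : 0 < orient (p v) (p a) z) :
    c ≠ v := by
  rintro rfl
  obtain ⟨l, l0, l1, -, -, hl⟩ := exists_orient_of_mem_seg hz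
  rw [hl, orient_right] at hα
  rw [hl, orient_left] at hβ
  have h1 : 0 < orient (p b) (p c) (p d) := by
    by_contra! h; nlinarith
  have h2 : 0 < orient (p c) (p a) (p d) := by
    by_contra! h; nlinarith
  exact (hw.empty d hcd h2).not_gt h1

theorem mem_seg_trans {x y z w : ℝ × ℝ} (hz : z ∈ seg x y) (hw : w ∈ seg z x) : w ∈ seg x y :=
  (convex_segment x y).segment_subset hz (left_mem_segment ℝ x y) hw

theorem Wedge.edge_end {v a b c d : V} (hw : Wedge p H v a b) (hP : IsPlaneDrawing p H)
    (hcd : H.Adj c d) {z : ℝ × ℝ} (hz : z ∈ seg (p c) (p d)) (hα : 0 < orient (p b) (p v) z)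
    (hβ : 0 < orient (p v) (p a) z) (hγ : 0 ≤ orient (p a) (p b) z)
    (hγc : 0 ≤ orient (p a) (p b) (p c)) :
    0 ≤ orient (p b) (p v) (p c) ∧ 0 ≤ orient (p v) (p a) (p c) := by
  have hcv := hw.ends_ne hcd hz hα hβ
  have hdv := hw.ends_ne hcd.symm (by rwa [seg_comm]) hα hβ
  by_contra hc
  obtain ⟨y, hy, hyγ, h⟩ := exists_exit' hα hβ hγ hγc hc
  have hycd := mem_seg_trans hz hy
  have hD := hw.pos
  have hD' : 0 < orient (p b) (p v) (p a) := by rwa [← orient_rotate]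
  obtain ⟨l, l0, l1, -, -, hl⟩ := exists_orient_of_mem_seg hz
  obtain ⟨m, m0, m1, -, -, hm⟩ := exists_orient_of_mem_seg hy
  rcases h with ⟨h0, h1⟩ | ⟨h0, h1⟩
  · have hs := mem_seg_of_orient hD h0 h1 hyγ
    have hne : s(c, d) ≠ s(v, a) := by
      intro e; rw [Sym2.eq_iff] at e; tauto
    obtain ⟨e1, e2⟩ := hP.edges_meet hcd hw.left hne ⟨hycd, hs⟩
    have e3 : c = a ∨ d = a := by
      rcases e1 with rfl | rfl <;> rcases e2 with e | e
      · exact absurd (hP.inj e) hcv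
      · exact Or.inl (hP.inj e)
      · exact absurd (hP.inj e) hdv
      · exact Or.inr (hP.inj e)
    rcases e3 with rfl | rfl
    · exact hc ⟨hD'.le, (orient_right _ _).ge⟩
    · rw [hl, orient_right] at hβ
      have h2 : 0 < orient (p v) (p d) (p c) := by by_contra! h; nlinarith
      have h3 := hm (p v) (p d)
      rw [h0, hl, orient_right] at h3
      have : 0 < (1 - l) * orient (p v) (p d) (p c) := by linarith
      rcases m0.eq_or_lt with rfl | m0
      · linarith
      · nlinarith
  · have hs := mem_seg_of_orient hD' h0 hyγ h1
    have hne : s(c, d) ≠ s(b, v) := by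
      intro e; rw [Sym2.eq_iff] at e; tauto
    obtain ⟨e1, e2⟩ := hP.edges_meet hcd hw.right.symm hne ⟨hycd, hs⟩
    have e3 : c = b ∨ d = b := by
      rcases e1 with rfl | rfl <;> rcases e2 with e | e
      · exact Or.inl (hP.inj e)
      · exact absurd (hP.inj e) hcv
      · exact Or.inr (hP.inj e)
      · exact absurd (hP.inj e) hdv
    rcases e3 with rfl | rfl
    · exact hc ⟨(orient_left _ _).ge, hD.le⟩
    · rw [hl, orient_left] at hα
      have h2 : 0 < orient (p d) (p v) (p c) := by by_contra! h; nlinarith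
      have h3 := hm (p d) (p v)
      rw [h0, hl, orient_left] at h3
      have : 0 < (1 - l) * orient (p d) (p v) (p c) := by linarith
      rcases m0.eq_or_lt with rfl | m0
      · linarith
      · nlinarith

theorem Wedge.not_mem_triangle [Finite V] {v a b : V} (hw : Wedge p H v a b)
    (hmax : Maximal (IsPlaneDrawing p) H) {w : V} (hv : w ≠ v) (ha : w ≠ a) (hb : w ≠ b) :
    ¬ (0 ≤ orient (p b) (p v) (p w) ∧ 0 ≤ orient (p v) (p a) (p w) ∧
      0 ≤ orient (p a) (p b) (p w)) := by
  intro hmem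
  have hP := hmax.prop
  have hD := hw.pos
  have hD' : 0 < orient (p b) (p v) (p a) := by rwa [← orient_rotate]
  obtain ⟨w, ⟨hv, ha, hb, h1, h2, h3⟩, hbest⟩ := Set.exists_max_image
    {w | w ≠ v ∧ w ≠ a ∧ w ≠ b ∧ 0 ≤ orient (p b) (p v) (p w) ∧ 0 ≤ orient (p v) (p a) (p w) ∧
      0 ≤ orient (p a) (p b) (p w)} (fun w => orient (p a) (p b) (p w)) (Set.toFinite _)
      ⟨w, hv, ha, hb, hmem⟩
  replace hbest : ∀ x, x ≠ v → x ≠ a → x ≠ b → 0 ≤ orient (p b) (p v) (p x) →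
      0 ≤ orient (p v) (p a) (p x) → orient (p a) (p b) (p w) < orient (p a) (p b) (p x) →
      False := fun x e1 e2 e3 e4 e5 e6 =>
    (hbest x ⟨e1, e2, e3, e4, e5, h3.trans e6.le⟩).not_gt e6
  have hα : 0 < orient (p b) (p v) (p w) := h1.lt_of_ne' fun e =>
    hP.vertex_off hw.right.symm hb hv (mem_seg_of_orient hD' e h3 h2)
  have hβ : 0 < orient (p v) (p a) (p w) := h2.lt_of_ne' fun e =>
    hP.vertex_off hw.left hv ha (mem_seg_of_orient hD e h1 h3)
  have hsum := orient_add (p v) (p a) (p b) (p w)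
  have hseg : ∀ z ∈ seg (p v) (p w), z ≠ p v → z ≠ p w → 0 < orient (p b) (p v) z ∧
      0 < orient (p v) (p a) z ∧ orient (p a) (p b) (p w) < orient (p a) (p b) z := by
    intro z hz hzv hzw
    obtain ⟨l, l0, l1, e0, e1, hl⟩ := exists_orient_of_mem_seg hz
    have l0 : 0 < l := l0.lt_of_ne' fun e => hzv (e0 e)
    have l1 : l < 1 := l1.lt_of_ne fun e => hzw (e1 e)
    have h4 : orient (p a) (p b) (p v) = orient (p v) (p a) (p b) := orient_rotate _ _ _
    rw [hl, hl, hl, orient_right, orient_left, h4]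
    refine ⟨?_, ?_, ?_⟩ <;> nlinarith
  have hvw : ¬ H.Adj v w := fun h => (hw.empty w h hβ).not_gt hα
  rcases exists_obstruction hmax hv.symm hvw with ⟨x, hxv, hxw, hx⟩ | ⟨c, d, z, hcd, hz, hz', hzv, hzw⟩
  · obtain ⟨g1, g2, g3⟩ := hseg _ hx (hP.inj.ne hxv) (hP.inj.ne hxw)
    refine hbest x hxv ?_ ?_ g1.le g2.le g3
    · rintro rfl; rw [orient_right] at g2; exact lt_irrefl _ g2
    · rintro rfl; rw [orient_left] at g1; exact lt_irrefl _ g1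
  · obtain ⟨g1, g2, g3⟩ := hseg _ hz' hzv hzw
    have main : ∀ c d, H.Adj c d → z ∈ seg (p c) (p d) →
        orient (p a) (p b) z ≤ orient (p a) (p b) (p c) → False := by
      intro c d hcd hz hge
      obtain ⟨k1, k2⟩ := hw.edge_end hP hcd hz g1 g2 (h3.trans g3.le)
        ((h3.trans g3.le).trans hge)
      refine hbest c (hw.ends_ne hcd hz g1 g2) ?_ ?_ k1 k2 (g3.trans_le hge)
      · rintro rfl; rw [orient_left] at hge; linarith
      · rintro rfl; rw [orient_right] at hge; linarith
    obtain ⟨l, l0, l1, -, -, hl⟩ := exists_orient_of_mem_seg hz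
    rcases le_or_gt (orient (p a) (p b) z) (orient (p a) (p b) (p c)) with h | h
    · exact main c d hcd hz h
    · refine main d c hcd.symm (by rwa [seg_comm]) ?_
      by_contra! h'
      have := hl (p a) (p b)
      rcases l0.eq_or_lt with rfl | l0
      · linarith
      · nlinarith

theorem Wedge.adj [Finite V] {v a b : V} (hw : Wedge p H v a b)
    (hmax : Maximal (IsPlaneDrawing p) H) : H.Adj a b := by
  have hP := hmax.prop
  have hD := hw.pos
  have hD' : orient (p b) (p v) (p a) = orient (p v) (p a) (p b) := (orient_rotate _ _ _).symm
  have hD2 : orient (p a) (p b) (p v) = orient (p v) (p a) (p b) := orient_rotate _ _ _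
  by_contra hab
  have hne : a ≠ b := by
    rintro rfl; rw [orient_right] at hD; exact lt_irrefl _ hD
  have hseg : ∀ z ∈ seg (p a) (p b), z ≠ p a → z ≠ p b → 0 < orient (p b) (p v) z ∧
      0 < orient (p v) (p a) z ∧ orient (p a) (p b) z = 0 := by
    intro z hz hzv hzw
    obtain ⟨l, l0, l1, e0, e1, hl⟩ := exists_orient_of_mem_seg hz
    have l0 : 0 < l := l0.lt_of_ne' fun e => hzv (e0 e)
    have l1 : l < 1 := l1.lt_of_ne fun e => hzw (e1 e)
    rw [hl, hl, hl, orient_right, orient_right, orient_left, orient_left, hD']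
    refine ⟨?_, ?_, ?_⟩ <;> nlinarith
  rcases exists_obstruction hmax hne hab with ⟨x, hxa, hxb, hx⟩ | ⟨c, d, z, hcd, hz, hz', hza, hzb⟩
  · obtain ⟨g1, g2, g3⟩ := hseg _ hx (hP.inj.ne hxa) (hP.inj.ne hxb)
    refine hw.not_mem_triangle hmax ?_ hxa hxb ⟨g1.le, g2.le, g3.ge⟩
    rintro rfl; linarith
  · obtain ⟨g1, g2, g3⟩ := hseg _ hz' hza hzb
    have main : ∀ c d, H.Adj c d → z ∈ seg (p c) (p d) →
        0 ≤ orient (p a) (p b) (p c) → c = a ∨ c = b := by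
      intro c d hcd hz hge
      obtain ⟨k1, k2⟩ := hw.edge_end hP hcd hz g1 g2 g3.ge hge
      by_contra! h
      exact hw.not_mem_triangle hmax (hw.ends_ne hcd hz g1 g2) h.1 h.2 ⟨k1, k2, hge⟩
    have main2 : ∀ c d, H.Adj c d → z ∈ seg (p c) (p d) →
        0 ≤ orient (p a) (p b) (p c) → False := by
      intro c d hcd hz hge
      obtain ⟨l, l0, l1, e0, e1, hl⟩ := exists_orient_of_mem_seg hz
      have hc := main c d hcd hz hge
      have l0 : 0 < l := l0.lt_of_ne' fun e => by
        rcases hc with rfl | rfl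
        · exact hza (e0 e)
        · exact hzb (e0 e)
      have hd0 : orient (p a) (p b) (p d) = 0 := by
        have := hl (p a) (p b)
        rw [g3] at this
        rcases hc with rfl | rfl
        · rw [orient_left] at this; nlinarith
        · rw [orient_right] at this; nlinarith
      have hd := main d c hcd.symm (by rwa [seg_comm]) hd0.ge
      rcases hc with rfl | rfl <;> rcases hd with rfl | rfl
      · exact hcd.ne rfl
      · exact hab hcd
      · exact hab hcd.symm
      · exact hcd.ne rfl
    obtain ⟨l, l0, l1, -, -, hl⟩ := exists_orient_of_mem_seg hz
    rcases le_or_gt 0 (orient (p a) (p b) (p c)) with h | h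
    · exact main2 c d hcd hz h
    · refine main2 d c hcd.symm (by rwa [seg_comm]) ?_
      by_contra! h'
      have := hl (p a) (p b)
      rcases l0.eq_or_lt with rfl | l0
      · linarith
      · nlinarith

/-- `v a b` is a counterclockwise triangle of `H` containing no further vertex. -/
structure IsTriFace (p : V → ℝ × ℝ) (H : SimpleGraph V) (v a b : V) : Prop where
  adj₁ : H.Adj v a
  adj₂ : H.Adj a b
  adj₃ : H.Adj b v
  pos : 0 < orient (p v) (p a) (p b)
  empty : ∀ w, w ≠ v → w ≠ a → w ≠ b → ¬ (0 ≤ orient (p b) (p v) (p w) ∧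
    0 ≤ orient (p v) (p a) (p w) ∧ 0 ≤ orient (p a) (p b) (p w))

theorem IsTriFace.rotate {v a b : V} (h : IsTriFace p H v a b) : IsTriFace p H a b v where
  adj₁ := h.adj₂
  adj₂ := h.adj₃
  adj₃ := h.adj₁
  pos := by rw [orient_rotate]; exact h.pos
  empty w h1 h2 h3 h4 := h.empty w h3 h1 h2 ⟨h4.2.2, h4.1, h4.2.1⟩

theorem exists_isTriFace [Finite V] (hmax : Maximal (IsPlaneDrawing p) H) {v a b₀ : V}
    (ha : H.Adj v a) (hb₀ : H.Adj v b₀) (h₀ : 0 < orient (p v) (p a) (p b₀)) :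
    ∃ b, IsTriFace p H v a b := by
  set dot : V → ℝ := fun w => ((p a).1 - (p v).1) * ((p w).1 - (p v).1) +
    ((p a).2 - (p v).2) * ((p w).2 - (p v).2) with hdot
  obtain ⟨b, ⟨hb, hpos⟩, hbest⟩ := Set.exists_max_image
    {w | H.Adj v w ∧ 0 < orient (p v) (p a) (p w)} (fun w => dot w / orient (p v) (p a) (p w))
    (Set.toFinite _) ⟨b₀, hb₀, h₀⟩
  have hw : Wedge p H v a b := by
    refine ⟨ha, hb, hpos, fun w hw hwpos => ?_⟩
    have h1 := hbest w ⟨hw, hwpos⟩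
    simp only [div_le_div_iff₀ hwpos hpos] at h1
    have e : (((p a).1 - (p v).1) ^ 2 + ((p a).2 - (p v).2) ^ 2) * orient (p b) (p v) (p w) =
        dot w * orient (p v) (p a) (p b) - dot b * orient (p v) (p a) (p w) := by
      simp only [hdot, orient]; ring
    have hne : 0 < ((p a).1 - (p v).1) ^ 2 + ((p a).2 - (p v).2) ^ 2 := by
      by_contra! h
      have h1 : (p a).1 - (p v).1 = 0 := by nlinarith [sq_nonneg ((p a).2 - (p v).2)]
      have h2 : (p a).2 - (p v).2 = 0 := by nlinarith [sq_nonneg ((p a).1 - (p v).1)]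
      exact ha.ne' (hmax.prop.inj (Prod.ext (by linarith) (by linarith)))
    by_contra! h
    nlinarith
  exact ⟨b, ha, hw.adj hmax, hb.symm, hpos, fun w => hw.not_mem_triangle hmax⟩

theorem IsTriFace.orient_nonpos (hP : IsPlaneDrawing p H) {v a b w : V} (hf : IsTriFace p H v a b)
    (hw : H.Adj v w) (h1 : 0 < orient (p v) (p a) (p w)) : orient (p v) (p w) (p b) ≤ 0 := by
  by_contra! h2
  rw [orient_rotate] at h2
  have hwa : w ≠ a := by rintro rfl; rw [orient_right] at h1; exact lt_irrefl _ h1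
  have hwb : w ≠ b := by rintro rfl; rw [orient_left] at h2; exact lt_irrefl _ h2
  rcases le_or_gt 0 (orient (p a) (p b) (p w)) with h | h
  · exact hf.empty w hw.ne' hwa hwb ⟨h2.le, h1.le, h⟩
  · have hsum := orient_add (p v) (p a) (p b) (p w)
    have hD := hf.pos
    set s := orient (p v) (p a) (p b) with hs
    set k := s / (orient (p b) (p v) (p w) + orient (p v) (p a) (p w)) with hk
    have hk0 : 0 ≤ k := by positivity
    have hk1 : k ≤ 1 := (div_le_one (by linarith)).2 (by linarith)
    set z : ℝ × ℝ := ((p v).1 + k * ((p w).1 - (p v).1), (p v).2 + k * ((p w).2 - (p v).2))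
    have hz : z ∈ seg (p v) (p w) := mem_seg_iff.2 ⟨k, hk0, hk1, rfl, rfl⟩
    have e1 : orient (p b) (p v) z = k * orient (p b) (p v) (p w) := by
      simp only [orient, z]; ring
    have e2 : orient (p v) (p a) z = k * orient (p v) (p a) (p w) := by
      simp only [orient, z]; ring
    have e3 : orient (p a) (p b) z = 0 := by
      have h3 : k * (orient (p b) (p v) (p w) + orient (p v) (p a) (p w)) = s :=
        div_mul_cancel₀ _ (by positivity)
      have := orient_add (p v) (p a) (p b) z
      rw [e1, e2] at this
      linarith
    have hz' : z ∈ seg (p a) (p b) := mem_seg_of_orient (by rw [orient_rotate]; exact hD) e3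
      (by rw [e2]; positivity) (by rw [e1]; positivity)
    have hne : s(v, w) ≠ s(a, b) := by
      intro e
      rcases Sym2.eq_iff.1 e with ⟨e, -⟩ | ⟨e, -⟩
      · exact hf.adj₁.ne e
      · exact hf.adj₃.ne' e
    obtain ⟨g1, g2⟩ := hP.edges_meet hw hf.adj₂ hne ⟨hz, hz'⟩
    rcases g1 with g1 | g1 <;> rcases g2 with g2 | g2 <;> have g := hP.inj (g1.symm.trans g2)
    · exact hf.adj₁.ne g
    · exact hf.adj₃.ne' g
    · exact hwa g
    · exact hwb g

theorem eq_of_collinear (hP : IsPlaneDrawing p H) {v b c : V} (hb : H.Adj v b) (hc : H.Adj v c)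
    (h : orient (p v) (p b) (p c) = 0) {x y : ℝ}
    (h1 : 0 < x * ((p b).1 - (p v).1) + y * ((p b).2 - (p v).2))
    (h2 : 0 < x * ((p c).1 - (p v).1) + y * ((p c).2 - (p v).2)) : b = c := by
  wlog hle : x * ((p c).1 - (p v).1) + y * ((p c).2 - (p v).2) ≤
    x * ((p b).1 - (p v).1) + y * ((p b).2 - (p v).2) generalizing b c
  · exact (this hc hb (by rw [orient_swap, h, neg_zero]) h2 h1 (le_of_not_ge hle)).symm
  by_contra hne
  refine hP.vertex_off hb hc.ne' (Ne.symm hne) (mem_seg_iff.2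
    ⟨(x * ((p c).1 - (p v).1) + y * ((p c).2 - (p v).2)) /
      (x * ((p b).1 - (p v).1) + y * ((p b).2 - (p v).2)), by positivity,
      (div_le_one h1).2 hle, ?_, ?_⟩)
  · field_simp
    simp only [orient] at h
    linear_combination -y * h
  · field_simp
    simp only [orient] at h
    linear_combination x * h

theorem IsTriFace.unique (hP : IsPlaneDrawing p H) {v a b c : V} (hb : IsTriFace p H v a b)
    (hc : IsTriFace p H v a c) : b = c := by
  have h1 := hb.orient_nonpos hP hc.adj₃.symm hc.pos
  have h2 := hc.orient_nonpos hP hb.adj₃.symm hb.pos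
  rw [orient_swap] at h1
  refine eq_of_collinear hP hb.adj₃.symm hc.adj₃.symm (by linarith)
    (x := -((p a).2 - (p v).2)) (y := (p a).1 - (p v).1) ?_ ?_
  · have := hb.pos; simp only [orient] at this; linarith
  · have := hc.pos; simp only [orient] at this; linarith

theorem exists_height [Finite V] (hp : Function.Injective p) :
    ∃ s : ℝ, Function.Injective fun v => (p v).1 + s * (p v).2 := by
  obtain ⟨s, hs⟩ := (Set.finite_range fun q : V × V =>
    -((p q.1).1 - (p q.2).1) / ((p q.1).2 - (p q.2).2)).exists_notMem
  refine ⟨s, fun u v huv => ?_⟩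
  by_contra hne
  dsimp only at huv
  refine hs ⟨(u, v), ?_⟩
  have h : (p u).2 - (p v).2 ≠ 0 := by
    intro h
    have h2 : (p u).2 = (p v).2 := by linarith
    rw [h2] at huv
    exact hne (hp (Prod.ext (by linarith) h2))
  dsimp only
  field_simp
  linarith

/-- Two darts at `v` on the same side of the vertical through `v` that are both either unfaced
or the start of a face straddling the vertical coincide. -/
theorem eq_of_same_side [Finite V] (hmax : Maximal (IsPlaneDrawing p) H) {s : ℝ} {v a c : V}
    (ha : H.Adj v a) (hc : H.Adj v c) {ξ : V → ℝ} (hξ : ∀ v, ξ v = (p v).1 + s * (p v).2)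
    (ha' : ∀ b, IsTriFace p H v a b → (ξ a - ξ v) * (ξ b - ξ v) < 0)
    (hc' : ∀ b, IsTriFace p H v c b → (ξ c - ξ v) * (ξ b - ξ v) < 0)
    (hside : 0 < (ξ a - ξ v) * (ξ c - ξ v)) : a = c := by
  wlog hpos : 0 ≤ orient (p v) (p a) (p c) generalizing a c
  · exact (this hc ha hc' ha' (by rwa [mul_comm]) (by rw [orient_swap]; linarith)).symm
  rcases hpos.eq_or_lt with h | h
  · rcases pos_and_pos_or_neg_and_neg_of_mul_pos hside with h1 | h1
    · exact eq_of_collinear hmax.prop ha hc h.symm (x := 1) (y := s)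
        (by linarith [h1.1, hξ a, hξ v]) (by linarith [h1.2, hξ c, hξ v])
    · exact eq_of_collinear hmax.prop ha hc h.symm (x := -1) (y := -s)
        (by linarith [h1.1, hξ a, hξ v]) (by linarith [h1.2, hξ c, hξ v])
  · obtain ⟨d, hd⟩ := exists_isTriFace hmax ha hc h
    exfalso
    have hX := hd.orient_nonpos hmax.prop hc h
    have hmid := ha' d hd
    have e : (ξ c - ξ v) * orient (p v) (p a) (p d) = (ξ a - ξ v) * orient (p v) (p c) (p d) +
        (ξ d - ξ v) * orient (p v) (p a) (p c) := by
      simp only [hξ, orient]; ring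
    have hD := hd.pos
    rcases pos_and_pos_or_neg_and_neg_of_mul_pos hside with ⟨h1, h2⟩ | ⟨h1, h2⟩
    · have h3 : ξ d - ξ v < 0 := by by_contra! h3; nlinarith
      nlinarith [mul_pos h2 hD, mul_nonneg h1.le (neg_nonneg.2 hX), mul_pos (neg_pos.2 h3) h]
    · have h3 : 0 < ξ d - ξ v := by by_contra! h3; nlinarith
      nlinarith [mul_pos (neg_pos.2 h2) hD, mul_nonneg (neg_nonneg.2 h1.le) (neg_nonneg.2 hX),
        mul_pos h3 h]

open Classical in
theorem card_midFaces_add_card_unfaced_le [Fintype V] (hmax : Maximal (IsPlaneDrawing p) H)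
    {s : ℝ} {ξ : V → ℝ} (hξ : ∀ v, ξ v = (p v).1 + s * (p v).2) (hinj : Function.Injective ξ) :
    (Finset.univ.filter fun t : V × V × V => IsTriFace p H t.1 t.2.1 t.2.2 ∧
      (ξ t.2.1 - ξ t.1) * (ξ t.2.2 - ξ t.1) < 0).card +
    (Finset.univ.filter fun q : V × V => H.Adj q.1 q.2 ∧ ∀ b, ¬ IsTriFace p H q.1 q.2 b).card ≤
      2 * Fintype.card V := by
  rw [← Finset.card_image_of_injOn (s := Finset.univ.filter fun t : V × V × V =>
    IsTriFace p H t.1 t.2.1 t.2.2 ∧ (ξ t.2.1 - ξ t.1) * (ξ t.2.2 - ξ t.1) < 0)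
    (f := fun t => (t.1, t.2.1)), ← Finset.card_union_of_disjoint]
  · have hcard : Fintype.card (V × Bool) = 2 * Fintype.card V := by
      rw [Fintype.card_prod, Fintype.card_bool, mul_comm]
    rw [← hcard, ← Finset.card_univ]
    refine Finset.card_le_card_of_injOn (fun q => (q.1, decide (ξ q.1 < ξ q.2)))
      (fun _ _ => Finset.mem_univ _) ?_
    have key : ∀ q ∈ (Finset.univ.filter fun t : V × V × V => IsTriFace p H t.1 t.2.1 t.2.2 ∧
      (ξ t.2.1 - ξ t.1) * (ξ t.2.2 - ξ t.1) < 0).image (fun t => (t.1, t.2.1)) ∪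
      Finset.univ.filter (fun q : V × V => H.Adj q.1 q.2 ∧ ∀ b, ¬ IsTriFace p H q.1 q.2 b),
        H.Adj q.1 q.2 ∧ ∀ b, IsTriFace p H q.1 q.2 b → (ξ q.2 - ξ q.1) * (ξ b - ξ q.1) < 0 := by
      intro q hq
      rcases Finset.mem_union.1 hq with hq | hq
      · obtain ⟨⟨v, a, b⟩, ht, rfl⟩ := Finset.mem_image.1 hq
        obtain ⟨-, hf, hlt⟩ := Finset.mem_filter.1 ht
        refine ⟨hf.adj₁, fun c hc => ?_⟩
        rw [← hf.unique hmax.prop hc]; exact hlt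
      · obtain ⟨-, h1, h2⟩ := Finset.mem_filter.1 hq
        exact ⟨h1, fun b hb => absurd hb (h2 b)⟩
    rintro ⟨v, a⟩ h1 ⟨v', c⟩ h2 h
    obtain ⟨rfl, h⟩ := Prod.mk.inj h
    obtain ⟨ha, ha'⟩ := key _ h1
    obtain ⟨hc, hc'⟩ := key _ h2
    dsimp only at *
    have hav : ξ a ≠ ξ v := hinj.ne ha.ne'
    have hcv : ξ c ≠ ξ v := hinj.ne hc.ne'
    rw [eq_of_same_side hmax ha hc hξ ha' hc']
    rw [decide_eq_decide] at h
    rcases hav.lt_or_gt with h1 | h1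
    · have h2 : ξ c < ξ v := hcv.lt_of_le (not_lt.1 fun h2 => (h.2 h2).not_gt h1)
      nlinarith
    · have h2 := h.1 h1
      nlinarith
  · rw [Finset.disjoint_left]
    rintro q h1 h2
    obtain ⟨⟨v, a, b⟩, ht, rfl⟩ := Finset.mem_image.1 h1
    exact (Finset.mem_filter.1 h2).2.2 b (Finset.mem_filter.1 ht).2.1
  · rintro ⟨v, a, b⟩ h1 ⟨v', a', b'⟩ h2 h
    obtain ⟨rfl, rfl⟩ := Prod.mk.inj h
    obtain rfl : b = b' := (Finset.mem_filter.1 h1).2.1.unique hmax.prop (Finset.mem_filter.1 h2).2.1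
    rfl

/-- Vertex-to-vertex form of the absence of 4-cycles. -/
def NoFourCycle (G : SimpleGraph V) : Prop :=
  ∀ ⦃x y u w : V⦄, x ≠ y → u ≠ w → G.Adj x u → G.Adj x w → G.Adj y u → G.Adj y w → False

open Classical in
theorem card_darts_le_of_drawing [Fintype V] {G : SimpleGraph V} (hG : IsPlaneDrawing p G)
    (hC : NoFourCycle G) :
    3 * (Finset.univ.filter fun q : V × V => G.Adj q.1 q.2).card ≤
      10 * Fintype.card V + 4 * (Finset.univ.filter fun s => G.IsNClique 3 s).card := by
  obtain ⟨H, hGH, hmax⟩ := (Set.toFinite {H | IsPlaneDrawing p H}).exists_le_maximal hG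
  replace hmax : Maximal (IsPlaneDrawing p) H := hmax
  have hP := hmax.prop
  obtain ⟨s, hs⟩ := exists_height hP.inj
  set ξ : V → ℝ := fun v => (p v).1 + s * (p v).2 with hξ
  have hK := card_midFaces_add_card_unfaced_le hmax (ξ := ξ) (fun v => rfl) hs
  set F := Finset.univ.filter fun t : V × V × V => IsTriFace p H t.1 t.2.1 t.2.2 with hF
  set M := Finset.univ.filter fun t : V × V × V => IsTriFace p H t.1 t.2.1 t.2.2 ∧
      (ξ t.2.1 - ξ t.1) * (ξ t.2.2 - ξ t.1) < 0 with hM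
  set N := Finset.univ.filter fun q : V × V => H.Adj q.1 q.2 ∧ ∀ b, ¬ IsTriFace p H q.1 q.2 b
    with hN
  set rot : V × V × V → V × V × V := fun t => (t.2.1, t.2.2, t.1) with hrot
  have hrotinj : Function.Injective rot := by
    rintro ⟨a, b, c⟩ ⟨a', b', c'⟩ h
    simp only [hrot, Prod.mk.injEq] at h ⊢
    tauto
  have hFM : F.card ≤ 3 * M.card := by
    have : F ⊆ M ∪ (M.image rot ∪ (M.image rot).image rot) := by
      rintro ⟨v, a, b⟩ ht
      have hf : IsTriFace p H v a b := (Finset.mem_filter.1 ht).2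
      have h1 : ξ a - ξ v ≠ 0 := sub_ne_zero.2 (hs.ne hf.adj₁.ne')
      have h2 : ξ b - ξ a ≠ 0 := sub_ne_zero.2 (hs.ne hf.adj₂.ne')
      have h3 : ξ v - ξ b ≠ 0 := sub_ne_zero.2 (hs.ne hf.adj₃.ne')
      have h4 : (ξ a - ξ v) * (ξ b - ξ v) < 0 ∨ (ξ b - ξ a) * (ξ v - ξ a) < 0 ∨
          (ξ v - ξ b) * (ξ a - ξ b) < 0 := by
        by_contra! h
        rcases h1.lt_or_gt with h1 | h1 <;> rcases h2.lt_or_gt with h2 | h2 <;>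
          rcases h3.lt_or_gt with h3 | h3 <;> nlinarith
      simp only [Finset.mem_union]
      rcases h4 with h4 | h4 | h4
      · exact Or.inl (Finset.mem_filter.2 ⟨Finset.mem_univ _, hf, h4⟩)
      · exact Or.inr (Or.inr (Finset.mem_image.2 ⟨(b, v, a), Finset.mem_image.2
          ⟨(a, b, v), Finset.mem_filter.2 ⟨Finset.mem_univ _, hf.rotate, h4⟩, rfl⟩, rfl⟩))
      · exact Or.inr (Or.inl (Finset.mem_image.2 ⟨(b, v, a), Finset.mem_filter.2
          ⟨Finset.mem_univ _, hf.rotate.rotate, h4⟩, rfl⟩))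
    have h1 := Finset.card_le_card this
    have h2 := Finset.card_union_le M (M.image rot ∪ (M.image rot).image rot)
    have h3 := Finset.card_union_le (M.image rot) ((M.image rot).image rot)
    have h4 := Finset.card_image_le (s := M) (f := rot)
    have h5 := Finset.card_image_le (s := M.image rot) (f := rot)
    omega
  set bits : V × V × V → Bool × Bool × Bool := fun t =>
    (decide (G.Adj t.1 t.2.1), decide (G.Adj t.2.1 t.2.2), decide (G.Adj t.2.2 t.1)) with hbits
  set c : Bool → Bool → Bool → Finset (V × V × V) := fun i j k =>
    F.filter fun t => bits t = (i, j, k) with hc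
  have hcrot : ∀ i j k, (c i j k).card ≤ (c j k i).card := by
    intro i j k
    refine Finset.card_le_card_of_injOn rot ?_ hrotinj.injOn
    rintro ⟨v, a, b⟩ ht
    obtain ⟨h1, h2⟩ := Finset.mem_filter.1 ht
    refine Finset.mem_filter.2 ⟨Finset.mem_filter.2 ⟨Finset.mem_univ _,
      (Finset.mem_filter.1 h1).2.rotate⟩, ?_⟩
    simp only [hbits, Prod.mk.injEq, hrot] at h2 ⊢
    tauto
  have hcmem : ∀ {i j k v a b}, (v, a, b) ∈ c i j k ↔ IsTriFace p H v a b ∧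
      decide (G.Adj v a) = i ∧ decide (G.Adj a b) = j ∧ decide (G.Adj b v) = k := by
    intro i j k v a b
    simp only [hc, hF, hbits, Finset.mem_filter, Finset.mem_univ, true_and, Prod.mk.injEq]
  have hFsum : F.card = ∑ q : Bool × Bool × Bool, (F.filter fun t => bits t = q).card :=
    Finset.card_eq_sum_card_fiberwise fun _ _ => Finset.mem_univ _
  rw [Fintype.sum_prod_type] at hFsum
  simp only [Fintype.sum_prod_type, Fintype.sum_bool] at hFsum
  have hT : (c true true true).card ≤ 3 * (Finset.univ.filter fun s => G.IsNClique 3 s).card := by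
    have hsig : ((Finset.univ.filter fun s => G.IsNClique 3 s).sigma fun s => s).card =
        3 * (Finset.univ.filter fun s => G.IsNClique 3 s).card := by
      rw [Finset.card_sigma, Finset.sum_congr rfl (fun s hs => (Finset.mem_filter.1 hs).2.card_eq),
        Finset.sum_const, smul_eq_mul, mul_comm]
    rw [← hsig]
    refine Finset.card_le_card_of_injOn (fun t => ⟨{t.1, t.2.1, t.2.2}, t.1⟩) ?_ ?_
    · rintro ⟨v, a, b⟩ ht
      obtain ⟨-, h1, h2, h3⟩ := hcmem.1 ht
      simp only [decide_eq_true_eq] at h1 h2 h3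
      simp only [Finset.coe_sigma, Set.mem_sigma_iff, Finset.mem_coe, Finset.mem_filter,
        Finset.mem_univ, true_and, Finset.mem_insert, true_or, and_true]
      exact SimpleGraph.is3Clique_triple_iff.2 ⟨h1, h3.symm, h2⟩
    · rintro ⟨v, a, b⟩ ht ⟨v', a', b'⟩ ht' h
      obtain ⟨h1, h2⟩ := Sigma.mk.inj h
      obtain rfl := eq_of_heq h2
      obtain ⟨hf, -⟩ := hcmem.1 ht
      obtain ⟨hf', -⟩ := hcmem.1 ht'
      dsimp only at h1
      have ha : a = a' ∨ a = b' := by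
        have : a ∈ ({v, a', b'} : Finset V) := by rw [← h1]; simp
        simpa [hf.adj₁.ne'] using this
      rcases ha with rfl | rfl
      · rw [hf.unique hP hf']
      · have hb : b = a' := by
          have : b ∈ ({v, a', a} : Finset V) := by rw [← h1]; simp
          simpa [hf.adj₂.ne', hf.adj₃.ne] using this
        subst hb
        have h3 := hf'.pos
        rw [orient_swap] at h3
        linarith [hf.pos]
  have hE : (Finset.univ.filter fun q : V × V => G.Adj q.1 q.2).card ≤
      (N.filter fun q => G.Adj q.1 q.2).card + ((c true true true).card +
        ((c true true false).card + ((c true false true).card + (c true false false).card))) := by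
    have : (Finset.univ.filter fun q : V × V => G.Adj q.1 q.2) ⊆
        N.filter (fun q => G.Adj q.1 q.2) ∪ (c true true true ∪ (c true true false ∪
          (c true false true ∪ c true false false))).image (fun t => (t.1, t.2.1)) := by
      rintro ⟨v, a⟩ hq
      have hva : G.Adj v a := (Finset.mem_filter.1 hq).2
      rw [Finset.mem_union]
      by_cases h : ∃ b, IsTriFace p H v a b
      · obtain ⟨b, hb⟩ := h
        refine Or.inr (Finset.mem_image.2 ⟨(v, a, b), ?_, rfl⟩)
        simp only [Finset.mem_union, hcmem, hva, hb, decide_true]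
        cases decide (G.Adj a b) <;> cases decide (G.Adj b v) <;> simp
      · push Not at h
        exact Or.inl (Finset.mem_filter.2 ⟨Finset.mem_filter.2 ⟨Finset.mem_univ _, hGH hva, h⟩, hva⟩)
    refine (Finset.card_le_card this).trans ((Finset.card_union_le _ _).trans ?_)
    refine Nat.add_le_add_left (Finset.card_image_le.trans ?_) _
    refine (Finset.card_union_le _ _).trans (Nat.add_le_add_left ?_ _)
    refine (Finset.card_union_le _ _).trans (Nat.add_le_add_left ?_ _)
    exact Finset.card_union_le _ _
  have hS : (c false true true).card ≤ (N.filter fun q => ¬ G.Adj q.1 q.2).card +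
      ((c false false false).card + ((c false true false).card + (c false false true).card)) := by
    have : (c false true true).image (fun t => (t.2.1, t.1)) ⊆
        N.filter (fun q => ¬ G.Adj q.1 q.2) ∪ (c false false false ∪ (c false true false ∪
          c false false true)).image (fun t => (t.1, t.2.1)) := by
      intro q hq
      obtain ⟨⟨v, a, b⟩, ht, rfl⟩ := Finset.mem_image.1 hq
      obtain ⟨hf, h1, h2, h3⟩ := hcmem.1 ht
      simp only [decide_eq_true_eq, decide_eq_false_iff_not] at h1 h2 h3
      have hav : ¬ G.Adj a v := fun h => h1 h.symm
      rw [Finset.mem_union]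
      by_cases h : ∃ b', IsTriFace p H a v b'
      · obtain ⟨b', hb'⟩ := h
        refine Or.inr (Finset.mem_image.2 ⟨(a, v, b'), ?_, rfl⟩)
        simp only [Finset.mem_union, hcmem, hav, hb', decide_false]
        have hno : ¬ (G.Adj v b' ∧ G.Adj b' a) := by
          rintro ⟨g1, g2⟩
          refine hC hf.adj₁.ne ?_ h3.symm g1 h2 g2.symm
          rintro rfl
          have g3 := hb'.pos
          rw [← orient_rotate, orient_swap] at g3
          linarith [hf.pos]
        by_cases k1 : G.Adj v b' <;> by_cases k2 : G.Adj b' a <;> simp [k1, k2] at hno ⊢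
      · push Not at h
        exact Or.inl (Finset.mem_filter.2 ⟨Finset.mem_filter.2
          ⟨Finset.mem_univ _, hf.adj₁.symm, h⟩, hav⟩)
    rw [← Finset.card_image_of_injOn (f := fun t : V × V × V => (t.2.1, t.1))]
    · refine (Finset.card_le_card this).trans ((Finset.card_union_le _ _).trans ?_)
      refine Nat.add_le_add_left (Finset.card_image_le.trans ?_) _
      refine (Finset.card_union_le _ _).trans (Nat.add_le_add_left ?_ _)
      exact Finset.card_union_le _ _
    · rintro ⟨v, a, b⟩ h1 ⟨v', a', b'⟩ h2 h
      obtain ⟨rfl, rfl⟩ := Prod.mk.inj h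
      obtain rfl : b = b' := (hcmem.1 h1).1.unique hP (hcmem.1 h2).1
      rfl
  have hNsum := Finset.card_filter_add_card_filter_not (s := N) (fun q => G.Adj q.1 q.2)
  have r1 := hcrot true true false
  have r2 := hcrot true false true
  have r3 := hcrot false true true
  have r4 := hcrot true false false
  have r5 := hcrot false false true
  have r6 := hcrot false true false
  simp only [hc] at *
  omega

open Classical in
theorem card_adj_le_of_drawing [Fintype V] {G : SimpleGraph V} (hG : IsPlaneDrawing p G)
    (hC : NoFourCycle G) (C : Finset V) :
    3 * ((C ×ˢ C).filter fun q => G.Adj q.1 q.2).card ≤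
      10 * C.card + 4 * (Finset.univ.filter fun s => G.IsNClique 3 s ∧ s ⊆ C).card := by
  set K : SimpleGraph C := G.comap Subtype.val with hK
  have hval : Function.Injective (Subtype.val : C → V) := Subtype.val_injective
  have hdraw : IsPlaneDrawing (fun x : C => p x) K := by
    refine ⟨hG.inj.comp hval, fun a b c d hab hcd hne => ?_, fun a b v hab hva hvb => ?_⟩
    · refine hG.edges_meet hab hcd fun h => hne ?_
      rw [Sym2.eq_iff] at h ⊢
      simpa only [Subtype.ext_iff] using h
    · exact hG.vertex_off hab (hval.ne hva) (hval.ne hvb)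
  have hC' : NoFourCycle K := fun x y u w h1 h2 h3 h4 h5 h6 =>
    hC (hval.ne h1) (hval.ne h2) h3 h4 h5 h6
  have h : 3 * (Finset.univ.filter fun q : C × C => K.Adj q.1 q.2).card ≤
      10 * C.card + 4 * (Finset.univ.filter fun s => K.IsNClique 3 s).card := by
    have h := card_darts_le_of_drawing hdraw hC'
    rw [Fintype.card_coe] at h
    convert h
  have h1 : ((C ×ˢ C).filter fun q => G.Adj q.1 q.2).card ≤
      (Finset.univ.filter fun q : C × C => K.Adj q.1 q.2).card := by
    refine Finset.card_le_card_of_surjOn (fun q => (q.1.1, q.2.1)) ?_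
    rintro ⟨x, y⟩ hq
    obtain ⟨hq, hadj⟩ := Finset.mem_filter.1 hq
    obtain ⟨hx, hy⟩ := Finset.mem_product.1 hq
    exact ⟨(⟨x, hx⟩, ⟨y, hy⟩), Finset.mem_filter.2 ⟨Finset.mem_univ _, hadj⟩, rfl⟩
  have h2 : (Finset.univ.filter fun s => K.IsNClique 3 s).card ≤
      (Finset.univ.filter fun s => G.IsNClique 3 s ∧ s ⊆ C).card := by
    refine Finset.card_le_card_of_injOn (fun s => s.map ⟨Subtype.val, hval⟩) ?_
      (Finset.map_injective _).injOn
    intro s hs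
    have hs := (Finset.mem_filter.1 hs).2
    refine Finset.mem_filter.2 ⟨Finset.mem_univ _, ⟨?_, ?_⟩, ?_⟩
    · intro x hx y hy hxy
      obtain ⟨x, hx', rfl⟩ := Finset.mem_map.1 hx
      obtain ⟨y, hy', rfl⟩ := Finset.mem_map.1 hy
      exact hs.isClique hx' hy' fun e => hxy (e ▸ rfl)
    · rw [Finset.card_map, hs.card_eq]
    · intro x hx
      obtain ⟨x, -, rfl⟩ := Finset.mem_map.1 hx
      exact x.2
  omega

end Drawing

section Hypergraph

open scoped Classical

variable {V : Type}

/-- The total of `|T ∩ X| - 1` over the blocks `T` meeting `X`. -/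
noncomputable def blockRank (𝒬 : Finset (Finset V)) (X : Finset V) : ℕ :=
  ∑ T ∈ 𝒬, ((T ∩ X).card - 1)

/-- The traces on `A` of the blocks `𝒬` form a hyperforest. -/
def IsForestOn (𝒬 : Finset (Finset V)) (A : Finset V) : Prop :=
  ∀ X ⊆ A, X.Nonempty → blockRank 𝒬 X + 1 ≤ X.card

theorem blockRank_add_le (𝒬 : Finset (Finset V)) (X Y : Finset V) :
    blockRank 𝒬 X + blockRank 𝒬 Y ≤ blockRank 𝒬 (X ∪ Y) + blockRank 𝒬 (X ∩ Y) := by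
  simp only [blockRank, ← Finset.sum_add_distrib]
  refine Finset.sum_le_sum fun T _ => ?_
  have h := Finset.card_union_add_card_inter (T ∩ X) (T ∩ Y)
  rw [← Finset.inter_union_distrib_left, ← Finset.inter_inter_distrib_left] at h
  have h1 : (T ∩ X).card ≤ (T ∩ (X ∪ Y)).card :=
    Finset.card_le_card (Finset.inter_subset_inter_left Finset.subset_union_left)
  have h2 : (T ∩ Y).card ≤ (T ∩ (X ∪ Y)).card :=
    Finset.card_le_card (Finset.inter_subset_inter_left Finset.subset_union_right)
  omega

/-- The components of a hyperforest: the sets that are tight for the forest inequality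
and contain every tight set they meet. -/
noncomputable def blockComponents (𝒬 : Finset (Finset V)) (A : Finset V) : Finset (Finset V) :=
  A.powerset.filter fun C => C.Nonempty ∧ blockRank 𝒬 C + 1 = C.card ∧
    ∀ Y ⊆ A, blockRank 𝒬 Y + 1 = Y.card → (C ∩ Y).Nonempty → Y ⊆ C

variable {𝒬 : Finset (Finset V)} {A : Finset V}

theorem IsForestOn.exists_component (hF : IsForestOn 𝒬 A) {X : Finset V} (hX : X ⊆ A)
    (hne : X.Nonempty) (ht : blockRank 𝒬 X + 1 = X.card) :
    ∃ C ∈ blockComponents 𝒬 A, X ⊆ C := by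
  obtain ⟨C, hC, hbest⟩ := Finset.exists_max_image
    (A.powerset.filter fun C => X ⊆ C ∧ blockRank 𝒬 C + 1 = C.card) Finset.card
    ⟨X, by simp [hX, ht]⟩
  simp only [Finset.mem_filter, Finset.mem_powerset] at hC hbest
  obtain ⟨hCA, hXC, hCt⟩ := hC
  refine ⟨C, ?_, hXC⟩
  simp only [blockComponents, Finset.mem_filter, Finset.mem_powerset]
  refine ⟨hCA, hne.mono hXC, hCt, fun Y hY hYt hCY => ?_⟩
  have h1 := blockRank_add_le 𝒬 C Y
  have h2 := hF (C ∩ Y) (Finset.inter_subset_left.trans hCA) hCY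
  have h3 := hF (C ∪ Y) (Finset.union_subset hCA hY) ((hne.mono hXC).mono Finset.subset_union_left)
  have h4 := Finset.card_union_add_card_inter C Y
  have h5 := hbest (C ∪ Y) ⟨Finset.union_subset hCA hY,
    hXC.trans Finset.subset_union_left, by omega⟩
  have h6 := Finset.eq_of_subset_of_card_le (Finset.subset_union_left : C ⊆ C ∪ Y) h5
  rw [h6]
  exact Finset.subset_union_right

theorem IsForestOn.exists_component_mem (hF : IsForestOn 𝒬 A) {v : V} (hv : v ∈ A) :
    ∃ C ∈ blockComponents 𝒬 A, v ∈ C := by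
  have h0 : blockRank 𝒬 {v} + 1 = ({v} : Finset V).card := by
    have := hF {v} (by simpa using hv) (by simp)
    rw [Finset.card_singleton] at *
    omega
  obtain ⟨C, hC, hvC⟩ := hF.exists_component (by simpa using hv) (by simp) h0
  exact ⟨C, hC, by simpa using hvC⟩

theorem mem_blockComponents {C : Finset V} : C ∈ blockComponents 𝒬 A ↔ C ⊆ A ∧ C.Nonempty ∧
    blockRank 𝒬 C + 1 = C.card ∧
    ∀ Y ⊆ A, blockRank 𝒬 Y + 1 = Y.card → (C ∩ Y).Nonempty → Y ⊆ C := by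
  simp only [blockComponents, Finset.mem_filter, Finset.mem_powerset]

theorem eq_of_mem_blockComponents {C D : Finset V} (hC : C ∈ blockComponents 𝒬 A)
    (hD : D ∈ blockComponents 𝒬 A) (h : (C ∩ D).Nonempty) : C = D := by
  obtain ⟨hCA, -, hCt, hCm⟩ := mem_blockComponents.1 hC
  obtain ⟨hDA, -, hDt, hDm⟩ := mem_blockComponents.1 hD
  exact (hDm C hCA hCt (by rwa [Finset.inter_comm])).antisymm (hCm D hDA hDt h)

theorem IsForestOn.block_subset (hF : IsForestOn 𝒬 A) {C T : Finset V}
    (hC : C ∈ blockComponents 𝒬 A) (hT : T ∈ 𝒬) (h : (T ∩ C).Nonempty) : T ∩ A ⊆ C := by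
  obtain ⟨hCA, hCne, hCt, hCm⟩ := mem_blockComponents.1 hC
  have hYA : C ∪ T ∩ A ⊆ A := Finset.union_subset hCA Finset.inter_subset_right
  refine Finset.subset_union_right.trans (hCm (C ∪ T ∩ A) hYA ?_ ?_)
  · have h1 := hF _ hYA (hCne.mono Finset.subset_union_left)
    have h2 : blockRank 𝒬 C + ((T ∩ (C ∪ T ∩ A)).card - (T ∩ C).card) ≤
        blockRank 𝒬 (C ∪ T ∩ A) := by
      simp only [blockRank]
      rw [← Finset.add_sum_erase _ _ hT, ← Finset.add_sum_erase 𝒬 _ hT]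
      have h3 : ∑ S ∈ 𝒬.erase T, ((S ∩ C).card - 1) ≤
          ∑ S ∈ 𝒬.erase T, ((S ∩ (C ∪ T ∩ A)).card - 1) := by
        refine Finset.sum_le_sum fun S _ => Nat.sub_le_sub_right (Finset.card_le_card ?_) 1
        exact Finset.inter_subset_inter_left Finset.subset_union_left
      have h4 : (T ∩ C).card ≤ (T ∩ (C ∪ T ∩ A)).card :=
        Finset.card_le_card (Finset.inter_subset_inter_left Finset.subset_union_left)
      have h5 := h.card_pos
      omega
    have h3 := Finset.card_union_add_card_inter C (T ∩ A)
    have h4 : T ∩ (C ∪ T ∩ A) = T ∩ A := by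
      ext x
      simp only [Finset.mem_inter, Finset.mem_union]
      exact ⟨fun h => ⟨h.1, h.2.elim (fun g => hCA g) fun g => g.2⟩, fun h => ⟨h.1, Or.inr h⟩⟩
    have h5 : C ∩ (T ∩ A) = T ∩ C := by
      ext x
      simp only [Finset.mem_inter]
      exact ⟨fun h => ⟨h.2.1, h.1⟩, fun h => ⟨h.2, h.1, hCA h.2⟩⟩
    rw [h4] at h2
    rw [h5] at h3
    omega
  · rwa [Finset.inter_eq_left.2 Finset.subset_union_left]

theorem IsForestOn.blockRank_split (hF : IsForestOn 𝒬 A) {C X : Finset V}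
    (hC : C ∈ blockComponents 𝒬 A) (hX : X ⊆ A) :
    blockRank 𝒬 X ≤ blockRank 𝒬 (X ∩ C) + blockRank 𝒬 (X \ C) := by
  simp only [blockRank, ← Finset.sum_add_distrib]
  refine Finset.sum_le_sum fun T hT => ?_
  by_cases h : (T ∩ C).Nonempty
  · have h1 := hF.block_subset hC hT h
    have h2 : T ∩ (X ∩ C) = T ∩ X := by
      ext x
      simp only [Finset.mem_inter]
      exact ⟨fun h => ⟨h.1, h.2.1⟩, fun h => ⟨h.1, h.2, h1 (Finset.mem_inter.2 ⟨h.1, hX h.2⟩)⟩⟩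
    rw [h2]
    exact Nat.le_add_right _ _
  · have h2 : T ∩ (X \ C) = T ∩ X := by
      ext x
      simp only [Finset.mem_inter, Finset.mem_sdiff]
      exact ⟨fun h => ⟨h.1, h.2.1⟩,
        fun g => ⟨g.1, g.2, fun k => h ⟨x, Finset.mem_inter.2 ⟨g.1, k⟩⟩⟩⟩
    rw [h2]
    exact Nat.le_add_left _ _

/-- A three-element set that cannot be added to a hyperforest has two elements in a component. -/
theorem IsForestOn.exists_two_le_card_inter (hF : IsForestOn 𝒬 A) {T : Finset V} (hTA : T ⊆ A)
    (hT : T.card = 3) (hadd : T ∈ 𝒬 ∨ ¬ IsForestOn (insert T 𝒬) A) :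
    ∃ C ∈ blockComponents 𝒬 A, 2 ≤ (T ∩ C).card := by
  by_cases hTQ : T ∈ 𝒬
  · obtain ⟨x, hx⟩ : T.Nonempty := Finset.card_pos.1 (by omega)
    obtain ⟨C, hC, hxC⟩ := hF.exists_component_mem (hTA hx)
    have h := hF.block_subset hC hTQ ⟨x, Finset.mem_inter.2 ⟨hx, hxC⟩⟩
    rw [Finset.inter_eq_left.2 hTA] at h
    exact ⟨C, hC, by rw [Finset.inter_eq_left.2 h]; omega⟩
  have hnot := hadd.resolve_left hTQ
  simp only [IsForestOn] at hnot
  push Not at hnot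
  obtain ⟨X, hX, hne, hlt⟩ := hnot
  have hins : blockRank (insert T 𝒬) X = (T ∩ X).card - 1 + blockRank 𝒬 X := by
    rw [blockRank, Finset.sum_insert hTQ, blockRank]
  rw [hins] at hlt
  have hX1 := hF X hX hne
  by_cases htight : blockRank 𝒬 X + 1 = X.card
  · obtain ⟨C, hC, hXC⟩ := hF.exists_component hX hne htight
    refine ⟨C, hC, le_trans ?_ (Finset.card_le_card (Finset.inter_subset_inter_left hXC))⟩
    omega
  · by_contra! hno
    have h3 : (T ∩ X).card ≤ T.card := Finset.card_le_card Finset.inter_subset_left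
    have hTX : T ⊆ X := by
      rw [← Finset.eq_of_subset_of_card_le (Finset.inter_subset_left : T ∩ X ⊆ T) (by omega)]
      exact Finset.inter_subset_right
    obtain ⟨x, y, z, hxy, hxz, hyz, rfl⟩ := Finset.card_eq_three.1 hT
    have hx : x ∈ X := hTX (by simp)
    have hy : y ∈ X := hTX (by simp)
    have hz : z ∈ X := hTX (by simp)
    have sep : ∀ {C : Finset V} {u w : V}, C ∈ blockComponents 𝒬 A → u ∈ ({x, y, z} : Finset V) →
        w ∈ ({x, y, z} : Finset V) → u ≠ w → u ∈ C → w ∉ C := by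
      intro C u w hC hu hw huw huC hwC
      have := Finset.one_lt_card.2 ⟨u, Finset.mem_inter.2 ⟨hu, huC⟩, w,
        Finset.mem_inter.2 ⟨hw, hwC⟩, huw⟩
      have := hno C hC
      omega
    obtain ⟨C, hC, hxC⟩ := hF.exists_component_mem (hX hx)
    obtain ⟨D, hD, hyD⟩ := hF.exists_component_mem (hX hy)
    have hyC : y ∉ C := sep hC (by simp) (by simp) hxy hxC
    have hzC : z ∉ C := sep hC (by simp) (by simp) hxz hxC
    have hzD : z ∉ D := sep hD (by simp) (by simp) hyz hyD
    have k1 := hF.blockRank_split hC hX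
    have k2 := hF.blockRank_split hD (Finset.sdiff_subset.trans hX : X \ C ⊆ A)
    have k3 := hF (X ∩ C) (Finset.inter_subset_left.trans hX) ⟨x, by simp [hx, hxC]⟩
    have k4 := hF ((X \ C) ∩ D) (Finset.inter_subset_left.trans (Finset.sdiff_subset.trans hX))
      ⟨y, by simp [hy, hyC, hyD]⟩
    have k5 := hF ((X \ C) \ D) (Finset.sdiff_subset.trans (Finset.sdiff_subset.trans hX))
      ⟨z, by simp [hz, hzC, hzD]⟩
    have k6 := Finset.card_inter_add_card_sdiff X C
    have k7 := Finset.card_inter_add_card_sdiff (X \ C) D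
    omega

theorem sum_card_filter_le {ι β : Type*} (𝒞 : Finset ι) (S : Finset β) (R : ι → β → Prop)
    [∀ C, DecidablePred (R C)] (h : ∀ C ∈ 𝒞, ∀ D ∈ 𝒞, ∀ b ∈ S, R C b → R D b → C = D) :
    ∑ C ∈ 𝒞, (S.filter (R C)).card ≤ S.card := by
  rw [← Finset.card_biUnion]
  · refine Finset.card_le_card fun b hb => ?_
    obtain ⟨C, -, hb⟩ := Finset.mem_biUnion.1 hb
    exact (Finset.mem_filter.1 hb).1
  · intro C hC D hD hne
    refine Finset.disjoint_left.2 ?_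
    intro b hb hb'
    exact hne (h C hC D hD b (Finset.mem_filter.1 hb).1 (Finset.mem_filter.1 hb).2
      (Finset.mem_filter.1 hb').2)

theorem sum_card_le_card_adj {G : SimpleGraph V} {𝒯 : Finset (Finset V)}
    (hcl : ∀ T ∈ 𝒯, G.IsClique T) (hpair : ∀ S ∈ 𝒯, ∀ T ∈ 𝒯, S ≠ T → (S ∩ T).card ≤ 1)
    (C : Finset V) : ∑ T ∈ 𝒯, (T ∩ C).card * ((T ∩ C).card - 1) ≤
      ((C ×ˢ C).filter fun q => G.Adj q.1 q.2).card := by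
  have h : ∀ T ∈ 𝒯, (T ∩ C).card * ((T ∩ C).card - 1) = (T ∩ C).offDiag.card := by
    intro T _
    rw [Finset.offDiag_card, Nat.mul_sub, mul_one]
  rw [Finset.sum_congr rfl h, ← Finset.card_biUnion]
  · refine Finset.card_le_card ?_
    rintro ⟨x, y⟩ hq
    obtain ⟨T, hT, hq⟩ := Finset.mem_biUnion.1 hq
    obtain ⟨hx, hy, hxy⟩ := Finset.mem_offDiag.1 hq
    obtain ⟨hx, hxC⟩ := Finset.mem_inter.1 hx
    obtain ⟨hy, hyC⟩ := Finset.mem_inter.1 hy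
    exact Finset.mem_filter.2 ⟨Finset.mem_product.2 ⟨hxC, hyC⟩, hcl T hT hx hy hxy⟩
  · intro S hS T hT hne
    refine Finset.disjoint_left.2 ?_
    rintro ⟨x, y⟩ hq hq'
    obtain ⟨hx, hy, hxy⟩ := Finset.mem_offDiag.1 hq
    obtain ⟨hx', hy', -⟩ := Finset.mem_offDiag.1 hq'
    simp only [Finset.mem_inter] at hx hy hx' hy'
    refine (hpair S hS T hT hne).not_gt (Finset.one_lt_card.2 ⟨x, ?_, y, ?_, hxy⟩) <;>
      simp [hx, hy, hx', hy']

theorem NoFourCycle.card_inter_le_one {G : SimpleGraph V} (hC : NoFourCycle G) {S T : Finset V}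
    (hS : G.IsNClique 3 S) (hT : G.IsNClique 3 T) (hne : S ≠ T) : (S ∩ T).card ≤ 1 := by
  by_contra! h
  obtain ⟨x, hx, y, hy, hxy⟩ := Finset.one_lt_card.1 h
  rw [Finset.mem_inter] at hx hy
  have third : ∀ {S : Finset V}, G.IsNClique 3 S → x ∈ S → y ∈ S →
      ∃ u, S = {x, y, u} ∧ G.Adj x u ∧ G.Adj y u := by
    intro S hS hx hy
    obtain ⟨u, hu⟩ : ∃ u, S \ {x, y} = {u} := by
      rw [← Finset.card_eq_one, Finset.card_sdiff_of_subset (by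
        intro z hz; simp only [Finset.mem_insert, Finset.mem_singleton] at hz
        rcases hz with rfl | rfl <;> assumption), hS.card_eq, Finset.card_pair hxy]
    have huS : u ∈ S \ {x, y} := by rw [hu]; simp
    simp only [Finset.mem_sdiff, Finset.mem_insert, Finset.mem_singleton, not_or] at huS
    refine ⟨u, ?_, hS.isClique hx huS.1 (Ne.symm huS.2.1), hS.isClique hy huS.1 (Ne.symm huS.2.2)⟩
    ext z
    have hz : z ∈ S \ {x, y} ↔ z = u := by rw [hu]; simp
    simp only [Finset.mem_sdiff, Finset.mem_insert, Finset.mem_singleton] at hz ⊢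
    by_cases h1 : z = x
    · simp [h1, hx]
    by_cases h2 : z = y
    · simp [h2, hy]
    tauto
  obtain ⟨u, rfl, h1, h2⟩ := third hS hx.1 hy.1
  obtain ⟨w, rfl, h3, h4⟩ := third hT hx.2 hy.2
  exact hC hxy (fun e => hne (by rw [e])) h1 h3 h2 h4

/-- In a sufficiently sparse graph without 4-cycles, a maximal hyperforest of triangles
leaves few edges uncovered. -/
theorem card_thin_add_blockRank_le [Fintype V] {G : SimpleGraph V} (hC4 : NoFourCycle G)
    (hdens : ∀ C : Finset V, 3 * ((C ×ˢ C).filter fun q => G.Adj q.1 q.2).card ≤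
      10 * C.card + 4 * (Finset.univ.filter fun s => G.IsNClique 3 s ∧ s ⊆ C).card)
    (h3 : ∀ T ∈ 𝒬, G.IsNClique 3 T) (h2 : ∀ T ∈ 𝒬, 2 ≤ (T ∩ A).card) (hF : IsForestOn 𝒬 A)
    (hmax : ∀ T, G.IsNClique 3 T → T ⊆ A → T ∈ 𝒬 ∨ ¬ IsForestOn (insert T 𝒬) A)
    {E : Finset (Finset V)} (hE : ∀ i ∈ E, G.IsNClique 2 i ∧ i ⊆ A ∧ ∀ T ∈ 𝒬, ¬ i ⊆ T) :
    E.card + blockRank 𝒬 A ≤ 2 * A.card := by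
  set Tri := Finset.univ.filter fun s => G.IsNClique 3 s ∧ s ⊆ A with hTri
  set Θ := 𝒬.filter fun T => ¬ T ⊆ A with hΘ
  set Q := 𝒬.filter fun T => T ⊆ A with hQ
  have hinter : ∀ {T B : Finset V}, G.IsNClique 3 T → ¬ T ⊆ B → (T ∩ B).card ≤ 2 := by
    intro T B hT hB
    have h1 : (T ∩ B).card < T.card := Finset.card_lt_card
      ⟨Finset.inter_subset_left, fun h => hB (h.trans Finset.inter_subset_right)⟩
    have := hT.card_eq
    omega
  have hinter3 : ∀ {T B : Finset V}, G.IsNClique 3 T → T ⊆ B → (T ∩ B).card = 3 := by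
    intro T B hT hB
    rw [Finset.inter_eq_left.2 hB, hT.card_eq]
  have hTriQ : ∀ T ∈ Q, T ∈ Tri := fun T hT => Finset.mem_filter.2
    ⟨Finset.mem_univ _, h3 T (Finset.mem_filter.1 hT).1, (Finset.mem_filter.1 hT).2⟩
  have hTri3 : ∀ T ∈ Tri ∪ Θ, G.IsNClique 3 T := by
    intro T hT
    rcases Finset.mem_union.1 hT with hT | hT
    · exact (Finset.mem_filter.1 hT).2.1
    · exact h3 T (Finset.mem_filter.1 hT).1
  have hdisj : Disjoint Tri Θ := by
    rw [Finset.disjoint_left]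
    exact fun T hT hT' => (Finset.mem_filter.1 hT').2 (Finset.mem_filter.1 hT).2.2
  have hrank : blockRank 𝒬 A = Θ.card + 2 * Q.card := by
    rw [blockRank, ← Finset.sum_filter_add_sum_filter_not 𝒬 (fun T => T ⊆ A), ← hQ, ← hΘ,
      Finset.sum_const_nat (m := 2), Finset.sum_const_nat (s := Θ) (m := 1)]
    · omega
    · intro T hT
      have g1 := hinter (h3 T (Finset.mem_filter.1 hT).1) (Finset.mem_filter.1 hT).2
      have g2 := h2 T (Finset.mem_filter.1 hT).1
      omega
    · intro T hT
      rw [hinter3 (h3 T (Finset.mem_filter.1 hT).1) (Finset.mem_filter.1 hT).2]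
  have hEA : 6 * Tri.card + 2 * Θ.card ≤ ((A ×ˢ A).filter fun q => G.Adj q.1 q.2).card := by
    refine le_trans ?_ (sum_card_le_card_adj (fun T hT => (hTri3 T hT).isClique)
      (fun S hS T hT hne => hC4.card_inter_le_one (hTri3 S hS) (hTri3 T hT) hne) A)
    rw [Finset.sum_union hdisj]
    refine add_le_add (le_of_eq_of_le ?_ (Finset.card_nsmul_le_sum Tri _ 6 ?_))
      (le_of_eq_of_le ?_ (Finset.card_nsmul_le_sum Θ _ 2 ?_))
    · rw [smul_eq_mul, mul_comm]
    · intro T hT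
      rw [hinter3 (Finset.mem_filter.1 hT).2.1 (Finset.mem_filter.1 hT).2.2]
    · rw [smul_eq_mul, mul_comm]
    · intro T hT
      have g2 := h2 T (Finset.mem_filter.1 hT).1
      calc 2 = 2 * (2 - 1) := rfl
        _ ≤ _ := Nat.mul_le_mul g2 (Nat.sub_le_sub_right g2 1)
  have hEthin : 2 * E.card + 2 * Θ.card + 6 * Q.card ≤
      ((A ×ˢ A).filter fun q => G.Adj q.1 q.2).card := by
    have hdisj' : Disjoint E 𝒬 := by
      rw [Finset.disjoint_left]
      exact fun i hi hi' => (hE i hi).2.2 i hi' subset_rfl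
    have hsmall : ∀ i ∈ E, ∀ T : Finset V, ¬ i ⊆ T → (i ∩ T).card ≤ 1 := by
      intro i hi T hiT
      have h1 : (i ∩ T).card < i.card := Finset.card_lt_card
        ⟨Finset.inter_subset_left, fun h => hiT (h.trans Finset.inter_subset_right)⟩
      have := (hE i hi).1.card_eq
      omega
    have hEE : ∀ i ∈ E, ∀ j ∈ E, i ≠ j → ¬ i ⊆ j := fun i hi j hj hne hij =>
      hne (Finset.eq_of_subset_of_card_le hij
        (by rw [(hE i hi).1.card_eq, (hE j hj).1.card_eq]))
    refine le_trans ?_ (sum_card_le_card_adj (𝒯 := E ∪ 𝒬) ?_ ?_ A)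
    · rw [Finset.sum_union hdisj', ← Finset.sum_filter_add_sum_filter_not 𝒬 (fun T => T ⊆ A),
        ← hQ, ← hΘ]
      have e1 : E.card • 2 ≤ ∑ i ∈ E, (i ∩ A).card * ((i ∩ A).card - 1) := by
        refine Finset.card_nsmul_le_sum E _ 2 fun i hi => ?_
        rw [Finset.inter_eq_left.2 (hE i hi).2.1, (hE i hi).1.card_eq]
      have e2 : Q.card • 6 ≤ ∑ i ∈ Q, (i ∩ A).card * ((i ∩ A).card - 1) := by
        refine Finset.card_nsmul_le_sum Q _ 6 fun T hT => ?_
        rw [hinter3 (h3 T (Finset.mem_filter.1 hT).1) (Finset.mem_filter.1 hT).2]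
      have e3 : Θ.card • 2 ≤ ∑ i ∈ Θ, (i ∩ A).card * ((i ∩ A).card - 1) := by
        refine Finset.card_nsmul_le_sum Θ _ 2 fun T hT => ?_
        have g2 := h2 T (Finset.mem_filter.1 hT).1
        calc 2 = 2 * (2 - 1) := rfl
          _ ≤ _ := Nat.mul_le_mul g2 (Nat.sub_le_sub_right g2 1)
      simp only [smul_eq_mul] at e1 e2 e3
      omega
    · intro T hT
      rcases Finset.mem_union.1 hT with hT | hT
      · exact (hE T hT).1.isClique
      · exact (h3 T hT).isClique
    · intro S hS T hT hne
      rcases Finset.mem_union.1 hS with hS | hS <;> rcases Finset.mem_union.1 hT with hT | hT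
      · exact hsmall S hS T (hEE S hS T hT hne)
      · exact hsmall S hS T ((hE S hS).2.2 T hT)
      · rw [Finset.inter_comm]; exact hsmall T hT S ((hE T hT).2.2 S hS)
      · exact hC4.card_inter_le_one (h3 S hS) (h3 T hT) hne
  have hcomp : ∀ C ∈ blockComponents 𝒬 A, 3 * (Tri.filter fun T => 2 ≤ (T ∩ C).card).card ≤
      11 * (Q.filter fun T => T ⊆ C).card + 3 * (Θ.filter fun T => (T ∩ C).card = 2).card := by
    intro C hC
    obtain ⟨hCA, -, hCt, -⟩ := mem_blockComponents.1 hC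
    have htri : (Tri.filter fun T => 2 ≤ (T ∩ C).card).card ≤
        (Tri.filter fun T => T ⊆ C).card + (Tri.filter fun T => (T ∩ C).card = 2).card := by
      rw [← Finset.card_union_add_card_inter]
      refine le_add_right (Finset.card_le_card fun T hT => ?_)
      obtain ⟨hT, hT2⟩ := Finset.mem_filter.1 hT
      by_cases h : T ⊆ C
      · exact Finset.mem_union_left _ (Finset.mem_filter.2 ⟨hT, h⟩)
      · have := hinter (Finset.mem_filter.1 hT).2.1 h
        exact Finset.mem_union_right _ (Finset.mem_filter.2 ⟨hT, by omega⟩)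
    have hn : blockRank 𝒬 C ≤ 2 * (Q.filter fun T => T ⊆ C).card +
        (Θ.filter fun T => (T ∩ C).card = 2).card := by
      rw [blockRank, ← Finset.sum_filter_add_sum_filter_not 𝒬 (fun T => T ⊆ A),
        Finset.card_filter, Finset.card_filter, Finset.mul_sum]
      refine add_le_add (Finset.sum_le_sum fun T hT => ?_) (Finset.sum_le_sum fun T hT => ?_)
      · obtain ⟨hT, hTA⟩ := Finset.mem_filter.1 hT
        rcases Finset.eq_empty_or_nonempty (T ∩ C) with h | h
        · simp [h]
        · have h1 := hF.block_subset hC hT h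
          rw [Finset.inter_eq_left.2 hTA] at h1
          simp [hinter3 (h3 T hT) h1, h1]
      · obtain ⟨hT, hTA⟩ := Finset.mem_filter.1 hT
        have := hinter (h3 T hT) (fun h : T ⊆ C => hTA (h.trans hCA))
        split_ifs <;> omega
    have hE1 : 6 * (Tri.filter fun T => T ⊆ C).card +
        2 * (Tri.filter fun T => (T ∩ C).card = 2).card +
        2 * (Θ.filter fun T => (T ∩ C).card = 2).card ≤
        ((C ×ˢ C).filter fun q => G.Adj q.1 q.2).card := by
      refine le_trans ?_ (sum_card_le_card_adj (fun T hT => (hTri3 T hT).isClique)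
        (fun S hS T hT hne => hC4.card_inter_le_one (hTri3 S hS) (hTri3 T hT) hne) C)
      rw [Finset.sum_union hdisj, Finset.card_filter, Finset.card_filter, Finset.card_filter,
        Finset.mul_sum, Finset.mul_sum, Finset.mul_sum, ← Finset.sum_add_distrib]
      refine add_le_add (Finset.sum_le_sum fun T hT => ?_) (Finset.sum_le_sum fun T hT => ?_)
      · by_cases h : T ⊆ C
        · simp [h, hinter3 (hTri3 T (Finset.mem_union_left _ hT)) h]
        · by_cases h' : (T ∩ C).card = 2 <;> simp [h, h']
      · by_cases h' : (T ∩ C).card = 2 <;> simp [h']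
    have hE2 : ((C ×ˢ C).filter fun q => G.Adj q.1 q.2).card ≤ C.card * (C.card - 1) := by
      have : C.offDiag.card = C.card * (C.card - 1) := by
        rw [Finset.offDiag_card, Nat.mul_sub, mul_one]
      rw [← this]
      refine Finset.card_le_card fun q hq => ?_
      obtain ⟨hq, hadj⟩ := Finset.mem_filter.1 hq
      exact Finset.mem_offDiag.2 ⟨(Finset.mem_product.1 hq).1, (Finset.mem_product.1 hq).2, hadj.ne⟩
    have hd := hdens C
    have htC : (Finset.univ.filter fun s => G.IsNClique 3 s ∧ s ⊆ C).card =
        (Tri.filter fun T => T ⊆ C).card := by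
      congr 1
      ext T
      simp only [hTri, Finset.mem_filter, Finset.mem_univ, true_and]
      exact ⟨fun h => ⟨⟨h.1, h.2.trans hCA⟩, h.2⟩, fun h => ⟨h.1.1, h.2⟩⟩
    rw [htC] at hd
    have hqt : (Q.filter fun T => T ⊆ C).card ≤ (Tri.filter fun T => T ⊆ C).card :=
      Finset.card_le_card fun T hT => Finset.mem_filter.2
        ⟨hTriQ T (Finset.mem_filter.1 hT).1, (Finset.mem_filter.1 hT).2⟩
    generalize (Tri.filter fun T => 2 ≤ (T ∩ C).card).card = t at *
    generalize (Tri.filter fun T => T ⊆ C).card = t3 at *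
    generalize (Tri.filter fun T => (T ∩ C).card = 2).card = t2 at *
    generalize (Q.filter fun T => T ⊆ C).card = q at *
    generalize (Θ.filter fun T => (T ∩ C).card = 2).card = θ at *
    generalize ((C ×ˢ C).filter fun q => G.Adj q.1 q.2).card = e at *
    rw [← hCt] at hE2 hd
    generalize blockRank 𝒬 C = r at *
    by_cases hq : 1 ≤ q ∨ 5 ≤ θ
    · omega
    · obtain rfl : q = 0 := by omega
      have hθ : θ ≤ 4 := by omega
      have hr : r ≤ 4 := by omega
      interval_cases θ <;> interval_cases r <;> omega
  have hsum1 : 3 * Tri.card ≤ ∑ C ∈ blockComponents 𝒬 A,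
      3 * (Tri.filter fun T => 2 ≤ (T ∩ C).card).card := by
    rw [← Finset.mul_sum]
    refine Nat.mul_le_mul_left 3 (le_trans (Finset.card_le_card ?_) Finset.card_biUnion_le)
    intro T hT
    obtain ⟨-, hT3, hTA⟩ := Finset.mem_filter.1 hT
    obtain ⟨C, hC, h⟩ := hF.exists_two_le_card_inter hTA hT3.card_eq (hmax T hT3 hTA)
    exact Finset.mem_biUnion.2 ⟨C, hC, Finset.mem_filter.2 ⟨hT, h⟩⟩
  have hsum2 := Finset.sum_le_sum hcomp
  rw [Finset.sum_add_distrib, ← Finset.mul_sum, ← Finset.mul_sum, ← Finset.mul_sum] at hsum2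
  have hsum3 := sum_card_filter_le (blockComponents 𝒬 A) Q (fun C T => T ⊆ C) (by
    intro C hC D hD T hT h h'
    refine eq_of_mem_blockComponents hC hD ?_
    have hT3 := (h3 T (Finset.mem_filter.1 hT).1).card_eq
    obtain ⟨x, hx⟩ := Finset.card_pos.1 (show 0 < T.card by omega)
    exact ⟨x, Finset.mem_inter.2 ⟨h hx, h' hx⟩⟩)
  have hsum4 := sum_card_filter_le (blockComponents 𝒬 A) Θ (fun C T => (T ∩ C).card = 2) (by
    intro C hC D hD T hT h h'
    refine eq_of_mem_blockComponents hC hD ?_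
    have hT3 := (h3 T (Finset.mem_filter.1 hT).1).card_eq
    have h4 := Finset.card_union_add_card_inter (T ∩ C) (T ∩ D)
    have h5 : (T ∩ C ∪ T ∩ D).card ≤ T.card :=
      Finset.card_le_card (Finset.union_subset Finset.inter_subset_left Finset.inter_subset_left)
    obtain ⟨x, hx⟩ := Finset.card_pos.1 (show 0 < (T ∩ C ∩ (T ∩ D)).card by omega)
    simp only [Finset.mem_inter] at hx
    exact ⟨x, Finset.mem_inter.2 ⟨hx.1.2, hx.2.2⟩⟩)
  have hd := hdens A
  rw [← hTri] at hd
  rw [← Finset.mul_sum] at hsum1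
  omega

/-- Hall's theorem assigns to every vertex of `U` enough exempt items, disjoint from `W`,
that it lies in at most two others. -/
theorem exists_exempt (I : Finset (Finset V)) {W U : Finset V} (hWU : Disjoint W U)
    (hW : ∀ S ⊆ U, blockRank I (W ∪ S) ≤ blockRank I W + 2 * S.card) :
    ∃ ex : V → Finset V → Prop,
      (∀ v i, ex v i → v ∈ U ∧ i ∈ I ∧ v ∈ i ∧ Disjoint i W) ∧
      (∀ u v i, ex u i → ex v i → u = v) ∧
      ∀ v ∈ U, (I.filter fun i => v ∈ i ∧ ¬ ex v i).card ≤ 2 := by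
  let r : V → ℕ := fun v => (I.filter fun i => v ∈ i).card
  let t : (Σ v : U, Fin (r v - 2)) → Finset (Finset V) := fun x =>
    I.filter fun i => (x.1 : V) ∈ i ∧ Disjoint i W
  have hall : ∀ s : Finset (Σ v : U, Fin (r v - 2)), s.card ≤ (s.biUnion t).card := by
    intro s
    set S' : Finset U := s.image fun x => x.1 with hS'
    set S : Finset V := S'.image Subtype.val with hS
    have hSU : S ⊆ U := by
      intro v hv
      obtain ⟨w, -, rfl⟩ := Finset.mem_image.1 hv
      exact w.2
    have h1 : s.card ≤ ∑ v ∈ S, (r v - 2) := by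
      have : s ⊆ S'.sigma fun _ => Finset.univ := fun x hx =>
        Finset.mem_sigma.2 ⟨Finset.mem_image_of_mem _ hx, Finset.mem_univ _⟩
      refine (Finset.card_le_card this).trans ?_
      rw [Finset.card_sigma, hS, Finset.sum_image Subtype.val_injective.injOn]
      simp
    have h2 : ∑ v ∈ S, (r v - 2) + 2 * S.card = ∑ v ∈ S, r v := by
      rw [mul_comm, ← smul_eq_mul, ← Finset.sum_const, ← Finset.sum_add_distrib]
      refine Finset.sum_congr rfl fun v hv => ?_
      obtain ⟨w, hw, rfl⟩ := Finset.mem_image.1 hv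
      obtain ⟨⟨w', k⟩, -, rfl⟩ := Finset.mem_image.1 hw
      have := k.2
      dsimp only at *
      omega
    have h3 : ∑ v ∈ S, r v = ∑ i ∈ I, (i ∩ S).card := by
      have := Finset.sum_card_bipartiteAbove_eq_sum_card_bipartiteBelow (s := S) (t := I)
        (fun v i => v ∈ i)
      refine this.trans (Finset.sum_congr rfl fun i _ => ?_)
      rw [Finset.inter_comm, Finset.bipartiteBelow, Finset.filter_mem_eq_inter]
    have h4 : blockRank I W + ∑ i ∈ I, (i ∩ S).card ≤ blockRank I (W ∪ S) +
        (I.filter fun i => (i ∩ S).Nonempty ∧ Disjoint i W).card := by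
      rw [blockRank, blockRank, Finset.card_filter, ← Finset.sum_add_distrib,
        ← Finset.sum_add_distrib]
      refine Finset.sum_le_sum fun i _ => ?_
      have hd : Disjoint (i ∩ W) (i ∩ S) :=
        hWU.mono Finset.inter_subset_right (Finset.inter_subset_right.trans hSU)
      rw [Finset.inter_union_distrib_left, Finset.card_union_of_disjoint hd]
      simp only [Finset.disjoint_iff_inter_eq_empty, ← Finset.card_pos, ← Finset.card_eq_zero]
      split_ifs <;> omega
    have h5 : (I.filter fun i => (i ∩ S).Nonempty ∧ Disjoint i W) ⊆ s.biUnion t := by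
      intro i hi
      obtain ⟨hi, ⟨v, hv⟩, hiW⟩ := Finset.mem_filter.1 hi
      obtain ⟨hvi, hvS⟩ := Finset.mem_inter.1 hv
      obtain ⟨w, hw, rfl⟩ := Finset.mem_image.1 hvS
      obtain ⟨x, hx, rfl⟩ := Finset.mem_image.1 hw
      exact Finset.mem_biUnion.2 ⟨x, hx, Finset.mem_filter.2 ⟨hi, hvi, hiW⟩⟩
    have h6 := Finset.card_le_card h5
    have h7 := hW S hSU
    omega
  obtain ⟨f, hf, hft⟩ := (Finset.all_card_le_biUnion_card_iff_exists_injective t).1 hall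
  refine ⟨fun v i => ∃ x, (x.1 : V) = v ∧ f x = i, ?_, ?_, ?_⟩
  · rintro _ _ ⟨x, rfl, rfl⟩
    obtain ⟨h1, h2, h3⟩ := Finset.mem_filter.1 (hft x)
    exact ⟨x.1.2, h1, h2, h3⟩
  · rintro _ _ _ ⟨x, rfl, rfl⟩ ⟨y, rfl, hxy⟩
    rw [hf hxy]
  · intro v hv
    have h1 : (Finset.univ.image fun k : Fin (r v - 2) => f ⟨⟨v, hv⟩, k⟩).card = r v - 2 := by
      rw [Finset.card_image_of_injective, Finset.card_univ, Fintype.card_fin]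
      intro k l hkl
      simpa using hf hkl
    have h2 : (Finset.univ.image fun k : Fin (r v - 2) => f ⟨⟨v, hv⟩, k⟩) ⊆
        (I.filter fun i => v ∈ i).filter fun i => ∃ x, (x.1 : V) = v ∧ f x = i := by
      intro i hi
      obtain ⟨k, -, rfl⟩ := Finset.mem_image.1 hi
      obtain ⟨g1, g2, -⟩ := Finset.mem_filter.1 (hft ⟨⟨v, hv⟩, k⟩)
      exact Finset.mem_filter.2 ⟨Finset.mem_filter.2 ⟨g1, g2⟩, _, rfl, rfl⟩
    have h3 := Finset.card_le_card h2
    have h4 := Finset.card_filter_add_card_filter_not (s := I.filter fun i => v ∈ i)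
      (fun i => ∃ x, (x.1 : V) = v ∧ f x = i)
    change _ + _ = r v at h4
    rw [← Finset.filter_filter]
    have h5 : ((I.filter fun i => v ∈ i).filter fun i =>
        ¬ ∃ x, (x.1 : V) = v ∧ f x = i).card ≤ 2 := by omega
    convert h5

/-- A proper coloring `φ` of `C` from the lists `L`, in the course of an extension from `W`:
no block forbids two colors at an uncolored vertex, a thin edge forbids no color unless it is
exempt, and a block that meets `C` contains its exempt vertex in `C`. -/
structure IsPartialColoring (G : SimpleGraph V) (L : V → Finset ℕ) (𝒬 E : Finset (Finset V))
    (ex : V → Finset V → Prop) (W C : Finset V) (φ : V → ℕ) : Prop where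
  mem : ∀ v ∈ C, φ v ∈ L v
  proper : ∀ u ∈ C, ∀ v ∈ C, G.Adj u v → φ u ≠ φ v
  block : ∀ T ∈ 𝒬, ∀ x ∈ T, ∀ y ∈ T, ∀ w ∈ T, x ≠ y → x ∈ C → y ∈ C → w ∉ C →
    ¬ (φ x ∈ L w ∧ φ y ∈ L w)
  thin : ∀ z ∈ C, z ∉ W → ∀ i ∈ E, z ∈ i → ¬ ex z i → ∀ u ∈ i, u ≠ z → φ z ∉ L u
  closed : ∀ T ∈ 𝒬, ∀ z, ex z T → ∀ x ∈ T, x ∈ C → z ∈ C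

theorem eq_of_card_eq_three {T : Finset V} (hT : T.card = 3) {v x y z : V} (hv : v ∈ T)
    (hx : x ∈ T) (hy : y ∈ T) (hz : z ∈ T) (hvx : v ≠ x) (hvy : v ≠ y) (hvz : v ≠ z)
    (hxy : x ≠ y) (hxz : x ≠ z) : y = z := by
  by_contra hyz
  have h : ({v, x, y, z} : Finset V) ⊆ T := by
    intro a ha
    simp only [Finset.mem_insert, Finset.mem_singleton] at ha
    rcases ha with rfl | rfl | rfl | rfl <;> assumption
  have h1 := Finset.card_le_card h
  rw [Finset.card_insert_of_notMem (by simp [hvx, hvy, hvz]),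
    Finset.card_eq_three.2 ⟨x, y, z, hxy, hxz, hyz, rfl⟩] at h1
  omega

theorem eq_of_mem_inter {S T : Finset ℕ} (h : (S ∩ T).card ≤ 1) {a b : ℕ} (ha : a ∈ S)
    (ha' : a ∈ T) (hb : b ∈ S) (hb' : b ∈ T) : a = b :=
  Finset.card_le_one.1 h a (Finset.mem_inter.2 ⟨ha, ha'⟩) b (Finset.mem_inter.2 ⟨hb, hb'⟩)

theorem exists_forall_ne {s : Set ℕ} (hs : s.Subsingleton) : ∃ b, ∀ c, c ≠ b → c ∉ s := by
  rcases s.eq_empty_or_nonempty with rfl | ⟨b, hb⟩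
  · exact ⟨0, fun c _ => by simp⟩
  · exact ⟨b, fun c hc h => hc (hs h hb)⟩

/-- Some uncolored vertex is not preceded by the exempt vertex of any of its blocks. -/
theorem IsForestOn.exists_next (hF : IsForestOn 𝒬 A) {ex : V → Finset V → Prop}
    (hexA : ∀ v, ∀ T ∈ 𝒬, ex v T → v ∈ A ∧ v ∈ T) (huniq : ∀ u v i, ex u i → ex v i → u = v)
    {C : Finset V} (hC : (A \ C).Nonempty) :
    ∃ v ∈ A \ C, ∀ T ∈ 𝒬, v ∈ T → ∀ z, ex z T → z ≠ v → z ∈ C := by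
  by_contra! h
  choose! T hT hvT z hz hzv hzC using h
  have h1 := hF (A \ C) Finset.sdiff_subset hC
  have h2 : (A \ C).card ≤ blockRank 𝒬 (A \ C) := by
    rw [Finset.card_eq_sum_card_fiberwise (f := T) (t := 𝒬) hT, blockRank]
    refine Finset.sum_le_sum fun S hS => ?_
    rcases ((A \ C).filter fun v => T v = S).eq_empty_or_nonempty with he | ⟨v, hv⟩
    · simp [he]
    obtain ⟨hvX, rfl⟩ := Finset.mem_filter.1 hv
    have hzX : z v ∈ T v ∩ (A \ C) := Finset.mem_inter.2
      ⟨(hexA _ _ (hT v hvX) (hz v hvX)).2, Finset.mem_sdiff.2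
        ⟨(hexA _ _ (hT v hvX) (hz v hvX)).1, hzC v hvX⟩⟩
    rw [← Finset.card_erase_of_mem hzX]
    refine Finset.card_le_card fun u hu => ?_
    obtain ⟨hu, huT⟩ := Finset.mem_filter.1 hu
    refine Finset.mem_erase.2 ⟨?_, Finset.mem_inter.2 ⟨huT ▸ hvT u hu, hu⟩⟩
    rintro rfl
    refine hzv _ hu (huniq _ _ _ (hz _ hu) ?_)
    rw [huT]
    exact hz v hvX
  omega

section Extension

variable {G : SimpleGraph V} {L : V → Finset ℕ} {E : Finset (Finset V)}
  {ex : V → Finset V → Prop} {W C : Finset V} {φ : V → ℕ}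

/-- A non-exempt thin edge forbids at most one color. -/
theorem exists_forbidden_of_thin (hL1 : ∀ ⦃u v⦄, G.Adj u v → (L u ∩ L v).card ≤ 1) {i : Finset V}
    (hi : G.IsNClique 2 i) {v : V} (hv : v ∈ i) :
    ∃ b, ∀ c ∈ L v, c ≠ b → ∀ u ∈ i, u ≠ v → c ∉ L u := by
  obtain ⟨b, hb⟩ := exists_forall_ne (s := {c | c ∈ L v ∧ ∃ u ∈ i, u ≠ v ∧ c ∈ L u}) (by
    rintro c ⟨hc, u, hu, huv, hcu⟩ c' ⟨hc', u', hu', hu'v, hcu'⟩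
    have huu : u = u' := by
      by_contra hne
      have h2 := hi.card_eq
      have := Finset.card_le_card (s := {v, u, u'}) (t := i) (by
        intro a ha
        simp only [Finset.mem_insert, Finset.mem_singleton] at ha
        rcases ha with rfl | rfl | rfl <;> assumption)
      rw [Finset.card_eq_three.2 ⟨v, u, u', huv.symm, hu'v.symm, hne, rfl⟩] at this
      omega
    subst huu
    exact eq_of_mem_inter (hL1 (hi.isClique hv hu huv.symm)) hc hcu hc' hcu')
  exact ⟨b, fun c hc hcb u hu huv hcu => hb c hcb ⟨hc, u, hu, huv, hcu⟩⟩

/-- A block forbids at most one color. -/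
theorem IsPartialColoring.exists_forbidden_of_block
    (hφ : IsPartialColoring G L 𝒬 E ex W C φ)
    (hL1 : ∀ ⦃u v⦄, G.Adj u v → (L u ∩ L v).card ≤ 1) {T : Finset V} (hT : T ∈ 𝒬)
    (hT3 : G.IsNClique 3 T) {v : V} (hv : v ∈ T) (hvC : v ∉ C) :
    ∃ b, ∀ c ∈ L v, c ≠ b → ∀ x ∈ T, x ∈ C → c ≠ φ x ∧
      ∀ y ∈ T, y ∉ C → y ≠ v → ¬ (c ∈ L y ∧ φ x ∈ L y) := by
  have hne : ∀ {x y}, x ∈ C → y ∉ C → x ≠ y := fun hx hy h => hy (h ▸ hx)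
  have key : ∀ c ∈ L v, ∀ x ∈ T, x ∈ C → ∀ x' ∈ T, x' ∈ C → ∀ y ∈ T, y ∉ C → y ≠ v →
      c ∈ L y → φ x' ∈ L y → φ x ∈ L v → φ x = c := by
    intro c hc x hx hxC x' hx' hxC' y hy hyC hyv hcy hxy hxv
    obtain rfl := eq_of_card_eq_three hT3.card_eq hv hy hx hx' hyv.symm (hne hxC hvC).symm
      (hne hxC' hvC).symm (hne hxC hyC).symm (hne hxC' hyC).symm
    exact eq_of_mem_inter (hL1 (hT3.isClique hv hy hyv.symm)) hxv hxy hc hcy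
  obtain ⟨b, hb⟩ := exists_forall_ne (s := {c | c ∈ L v ∧ ∃ x ∈ T, x ∈ C ∧ (c = φ x ∨
      ∃ y ∈ T, y ∉ C ∧ y ≠ v ∧ c ∈ L y ∧ φ x ∈ L y)}) (by
    rintro c ⟨hc, x, hx, hxC, h⟩ c' ⟨hc', x', hx', hxC', h'⟩
    rcases h with rfl | ⟨y, hy, hyC, hyv, hcy, hxy⟩ <;>
      rcases h' with rfl | ⟨y', hy', hyC', hyv', hcy', hxy'⟩
    · by_contra hne
      exact hφ.block T hT x hx x' hx' v hv (fun h => hne (h ▸ rfl)) hxC hxC' hvC ⟨hc, hc'⟩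
    · exact key c' hc' x hx hxC x' hx' hxC' y' hy' hyC' hyv' hcy' hxy' hc
    · exact (key c hc x' hx' hxC' x hx hxC y hy hyC hyv hcy hxy hc').symm
    · obtain rfl := eq_of_card_eq_three hT3.card_eq hv hx hy hy' (hne hxC hvC).symm hyv.symm
        hyv'.symm (hne hxC hyC) (hne hxC hyC')
      exact eq_of_mem_inter (hL1 (hT3.isClique hv hy hyv.symm)) hc hcy hc' hcy')
  exact ⟨b, fun c hc hcb x hx hxC => ⟨fun h => hb c hcb ⟨hc, x, hx, hxC, Or.inl h⟩,
    fun y hy hyC hyv h => hb c hcb ⟨hc, x, hx, hxC, Or.inr ⟨y, hy, hyC, hyv, h.1, h.2⟩⟩⟩⟩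

theorem IsPartialColoring.exists_insert (hφ : IsPartialColoring G L 𝒬 E ex W C φ)
    (hL3 : ∀ v, 3 ≤ (L v).card) (hL1 : ∀ ⦃u v⦄, G.Adj u v → (L u ∩ L v).card ≤ 1)
    (h3 : ∀ T ∈ 𝒬, G.IsNClique 3 T) (hF : IsForestOn 𝒬 A)
    (hE : ∀ i ∈ E, G.IsNClique 2 i ∧ i ⊆ A)
    (hcov : ∀ x ∈ A, ∀ y ∈ A, G.Adj x y → ∃ i ∈ E ∪ 𝒬, x ∈ i ∧ y ∈ i)
    (hex : ∀ v i, ex v i → v ∈ A \ W ∧ i ∈ E ∪ 𝒬 ∧ v ∈ i ∧ Disjoint i W)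
    (huniq : ∀ u v i, ex u i → ex v i → u = v)
    (hpaid : ∀ v ∈ A \ W, ((E ∪ 𝒬).filter fun i => v ∈ i ∧ ¬ ex v i).card ≤ 2)
    (hWC : W ⊆ C) (hCA : C ⊆ A) (hne : (A \ C).Nonempty) :
    ∃ v ∈ A \ C, ∃ c, IsPartialColoring G L 𝒬 E ex W (insert v C) (Function.update φ v c) := by
  obtain ⟨v, hv, hnext⟩ := hF.exists_next
    (fun u T _ h => ⟨(Finset.mem_sdiff.1 (hex u T h).1).1, (hex u T h).2.2.1⟩) huniq hne
  obtain ⟨hvA, hvC⟩ := Finset.mem_sdiff.1 hv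
  have hvW : v ∉ W := fun h => hvC (hWC h)
  have hforb : ∀ i ∈ (E ∪ 𝒬).filter fun i => v ∈ i ∧ ¬ ex v i, ∃ b, ∀ c ∈ L v, c ≠ b →
      (i ∈ E → ∀ u ∈ i, u ≠ v → c ∉ L u) ∧ (i ∈ 𝒬 → ∀ x ∈ i, x ∈ C → c ≠ φ x ∧
        ∀ y ∈ i, y ∉ C → y ≠ v → ¬ (c ∈ L y ∧ φ x ∈ L y)) := by
    intro i hi
    obtain ⟨hi, hvi, -⟩ := Finset.mem_filter.1 hi
    by_cases hiE : i ∈ E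
    · obtain ⟨b, hb⟩ := exists_forbidden_of_thin hL1 (hE i hiE).1 hvi
      refine ⟨b, fun c hc hcb => ⟨fun _ => hb c hc hcb, fun hiQ => ?_⟩⟩
      have h2 := (hE i hiE).1.card_eq
      have h3 := (h3 i hiQ).card_eq
      omega
    · have hiQ := (Finset.mem_union.1 hi).resolve_left hiE
      obtain ⟨b, hb⟩ := hφ.exists_forbidden_of_block hL1 hiQ (h3 i hiQ) hvi hvC
      exact ⟨b, fun c hc hcb => ⟨fun h => absurd h hiE, fun _ => hb c hc hcb⟩⟩
  choose! b hb using hforb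
  obtain ⟨c, hc, hcb⟩ : ∃ c ∈ L v,
      c ∉ ((E ∪ 𝒬).filter fun i => v ∈ i ∧ ¬ ex v i).image b := by
    refine Finset.exists_mem_notMem_of_card_lt_card ?_
    have h1 := hpaid v (Finset.mem_sdiff.2 ⟨hvA, hvW⟩)
    have h2 := hL3 v
    exact (Finset.card_image_le.trans h1).trans_lt h2
  have hthin : ∀ i ∈ E, v ∈ i → ¬ ex v i → ∀ u ∈ i, u ≠ v → c ∉ L u := by
    intro i hi hvi hvx
    have hm : i ∈ (E ∪ 𝒬).filter fun i => v ∈ i ∧ ¬ ex v i :=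
      Finset.mem_filter.2 ⟨Finset.mem_union_left 𝒬 hi, hvi, hvx⟩
    exact (hb i hm c hc fun h => hcb (h ▸ Finset.mem_image_of_mem b hm)).1 hi
  have hblock : ∀ T ∈ 𝒬, v ∈ T → ∀ x ∈ T, x ∈ C → c ≠ φ x ∧
      ∀ y ∈ T, y ∉ C → y ≠ v → ¬ (c ∈ L y ∧ φ x ∈ L y) := by
    intro T hT hvT x hx hxC
    by_cases hvx : ex v T
    · exact absurd (hφ.closed T hT v hvx x hx hxC) hvC
    have hm : T ∈ (E ∪ 𝒬).filter fun i => v ∈ i ∧ ¬ ex v i :=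
      Finset.mem_filter.2 ⟨Finset.mem_union_right E hT, hvT, hvx⟩
    exact (hb T hm c hc fun h => hcb (h ▸ Finset.mem_image_of_mem b hm)).2 hT x hx hxC
  have hadj : ∀ x ∈ C, G.Adj v x → c ≠ φ x := by
    intro x hx hvx
    obtain ⟨i, hi, hvi, hxi⟩ := hcov v hvA x (hCA hx) hvx
    rcases Finset.mem_union.1 hi with hi | hi
    · by_cases he : ex v i
      · have hxW : x ∉ W := Finset.disjoint_left.1 (hex v i he).2.2.2 hxi
        exact fun h => hφ.thin x hx hxW i hi hxi (fun h' => hvx.ne (huniq _ _ _ he h')) v hvi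
          hvx.ne (h ▸ hc)
      · exact fun h => hthin i hi hvi he x hxi hvx.ne' (h ▸ hφ.mem x hx)
    · exact (hblock i hi hvi x hxi hx).1
  have hupd : ∀ x ∈ C, Function.update φ v c x = φ x := by
    intro x hx
    refine Function.update_of_ne ?_ _ _
    rintro rfl
    exact hvC hx
  refine ⟨v, hv, c, ?_, ?_, ?_, ?_, ?_⟩
  · intro x hx
    rcases Finset.mem_insert.1 hx with rfl | hx
    · rwa [Function.update_self]
    · rw [hupd x hx]; exact hφ.mem x hx
  · intro x hx y hy hxy
    rcases Finset.mem_insert.1 hx with rfl | hxC <;> rcases Finset.mem_insert.1 hy with rfl | hyC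
    · exact (hxy.ne rfl).elim
    · rw [Function.update_self, hupd y hyC]; exact hadj y hyC hxy
    · rw [Function.update_self, hupd x hxC]; exact (hadj x hxC hxy.symm).symm
    · rw [hupd x hxC, hupd y hyC]; exact hφ.proper x hxC y hyC hxy
  · intro T hT x hxT y hyT w hwT hxy hx hy hw
    obtain ⟨hwv, hwC⟩ := not_or.1 (fun h => hw (Finset.mem_insert.2 h))
    rcases Finset.mem_insert.1 hx with rfl | hxC <;> rcases Finset.mem_insert.1 hy with rfl | hyC
    · exact (hxy rfl).elim
    · rw [Function.update_self, hupd y hyC]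
      exact (hblock T hT hxT y hyT hyC).2 w hwT hwC hwv
    · rw [Function.update_self, hupd x hxC]
      exact fun h => (hblock T hT hyT x hxT hxC).2 w hwT hwC hwv h.symm
    · rw [hupd x hxC, hupd y hyC]
      exact hφ.block T hT x hxT y hyT w hwT hxy hxC hyC hwC
  · intro z hz hzW i hi hzi hzx u hu huz
    rcases Finset.mem_insert.1 hz with rfl | hz
    · rw [Function.update_self]; exact hthin i hi hzi hzx u hu huz
    · rw [hupd z hz]; exact hφ.thin z hz hzW i hi hzi hzx u hu huz
  · intro T hT z hzT x hxT hx
    by_cases hzv : z = v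
    · exact hzv ▸ Finset.mem_insert_self _ _
    refine Finset.mem_insert_of_mem ?_
    rcases Finset.mem_insert.1 hx with rfl | hx
    · exact hnext T hT hxT z hzT hzv
    · exact hφ.closed T hT z hzT x hxT hx

theorem IsPartialColoring.exists_extension (hφ : IsPartialColoring G L 𝒬 E ex W C φ)
    (hL3 : ∀ v, 3 ≤ (L v).card) (hL1 : ∀ ⦃u v⦄, G.Adj u v → (L u ∩ L v).card ≤ 1)
    (h3 : ∀ T ∈ 𝒬, G.IsNClique 3 T) (hF : IsForestOn 𝒬 A)
    (hE : ∀ i ∈ E, G.IsNClique 2 i ∧ i ⊆ A)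
    (hcov : ∀ x ∈ A, ∀ y ∈ A, G.Adj x y → ∃ i ∈ E ∪ 𝒬, x ∈ i ∧ y ∈ i)
    (hex : ∀ v i, ex v i → v ∈ A \ W ∧ i ∈ E ∪ 𝒬 ∧ v ∈ i ∧ Disjoint i W)
    (huniq : ∀ u v i, ex u i → ex v i → u = v)
    (hpaid : ∀ v ∈ A \ W, ((E ∪ 𝒬).filter fun i => v ∈ i ∧ ¬ ex v i).card ≤ 2)
    (hWC : W ⊆ C) (hCA : C ⊆ A) : ∃ ψ, IsPartialColoring G L 𝒬 E ex W A ψ := by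
  induction hn : (A \ C).card using Nat.strong_induction_on generalizing C φ with
  | _ n ih =>
    subst hn
    rcases (A \ C).eq_empty_or_nonempty with he | hne
    · obtain rfl := hCA.antisymm (Finset.sdiff_eq_empty_iff_subset.1 he)
      exact ⟨φ, hφ⟩
    · obtain ⟨v, hv, c, h⟩ :=
        hφ.exists_insert hL3 hL1 h3 hF hE hcov hex huniq hpaid hWC hCA hne
      have hlt : (A \ insert v C).card < (A \ C).card := by
        refine Finset.card_lt_card (Finset.ssubset_iff_subset_ne.2
          ⟨Finset.sdiff_subset_sdiff subset_rfl (Finset.subset_insert v C), fun h => ?_⟩)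
        rw [← h] at hv
        simp at hv
      exact ih _ hlt h (hWC.trans (Finset.subset_insert v C))
        (Finset.insert_subset (Finset.mem_sdiff.1 hv).1 hCA) rfl

end Extension

theorem IsForestOn.mono (hF : IsForestOn 𝒬 A) {Q : Finset (Finset V)} {B : Finset V}
    (hQ : Q ⊆ 𝒬) (hB : B ⊆ A) : IsForestOn Q B := fun X hX hne =>
  le_trans (Nat.add_le_add_right (Finset.sum_le_sum_of_subset hQ) 1) (hF X (hX.trans hB) hne)

/-- A hyperforest `Θ` extends to one that is maximal with respect to adding triangles of `A`. -/
theorem IsForestOn.exists_maximal [Fintype V] (G : SimpleGraph V) {Θ : Finset (Finset V)}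
    (hF : IsForestOn Θ A) : ∃ 𝒬, Θ ⊆ 𝒬 ∧ (∀ T ∈ 𝒬, T ∈ Θ ∨ (G.IsNClique 3 T ∧ T ⊆ A)) ∧
      IsForestOn 𝒬 A ∧
      ∀ T, G.IsNClique 3 T → T ⊆ A → T ∈ 𝒬 ∨ ¬ IsForestOn (insert T 𝒬) A := by
  obtain ⟨𝒬, h𝒬, hmax⟩ := Finset.exists_max_image (Finset.univ.filter fun 𝒬 => Θ ⊆ 𝒬 ∧
    (∀ T ∈ 𝒬, T ∈ Θ ∨ (G.IsNClique 3 T ∧ T ⊆ A)) ∧ IsForestOn 𝒬 A) Finset.card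
    ⟨Θ, Finset.mem_filter.2 ⟨Finset.mem_univ _, subset_rfl, fun T hT => Or.inl hT, hF⟩⟩
  obtain ⟨-, hΘ, hT, hF'⟩ := Finset.mem_filter.1 h𝒬
  refine ⟨𝒬, hΘ, hT, hF', fun T hT3 hTA => or_iff_not_imp_left.2 fun hTQ hins => ?_⟩
  have := hmax (insert T 𝒬) (Finset.mem_filter.2 ⟨Finset.mem_univ _,
    hΘ.trans (Finset.subset_insert T 𝒬), fun S hS => ?_, hins⟩)
  · rw [Finset.card_insert_of_notMem hTQ] at this
    omega
  · rcases Finset.mem_insert.1 hS with rfl | hS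
    · exact Or.inr ⟨hT3, hTA⟩
    · exact hT S hS

/-- In a sparse set, some proper subset `W` maximizes the deficiency `blockRank I S - 2 |S|`. -/
theorem exists_proper_maximizer {I : Finset (Finset V)} (hA : A.Nonempty)
    (hI : blockRank I A ≤ 2 * A.card) : ∃ W ⊂ A, ∀ S ⊆ A,
      blockRank I S + 2 * W.card ≤ blockRank I W + 2 * S.card := by
  obtain ⟨W, hW, hmax⟩ := Finset.exists_max_image A.powerset
    (fun S => (blockRank I S : ℤ) - 2 * S.card) ⟨∅, by simp⟩
  simp only [Finset.mem_powerset] at hW hmax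
  rcases hW.eq_or_ssubset with rfl | hlt
  · refine ⟨∅, Finset.empty_ssubset.2 hA, fun S hS => ?_⟩
    have h1 := hmax S hS
    have h2 : blockRank I ∅ = 0 := by simp [blockRank]
    rw [h2, Finset.card_empty]
    omega
  · refine ⟨W, hlt, fun S hS => ?_⟩
    have h1 := hmax S hS
    omega

theorem exists_coloring_of_density [Fintype V] {G : SimpleGraph V} (hC4 : NoFourCycle G)
    (hdens : ∀ C : Finset V, 3 * ((C ×ˢ C).filter fun q => G.Adj q.1 q.2).card ≤
      10 * C.card + 4 * (Finset.univ.filter fun s => G.IsNClique 3 s ∧ s ⊆ C).card)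
    {L : V → Finset ℕ} (hL3 : ∀ v, 3 ≤ (L v).card)
    (hL1 : ∀ ⦃u v⦄, G.Adj u v → (L u ∩ L v).card ≤ 1) (A : Finset V) :
    ∀ Θ : Finset (Finset V), (∀ T ∈ Θ, G.IsNClique 3 T ∧ (T ∩ A).card = 2) →
      IsForestOn Θ A → ∃ φ : V → ℕ, (∀ v ∈ A, φ v ∈ L v) ∧
        (∀ u ∈ A, ∀ v ∈ A, G.Adj u v → φ u ≠ φ v) ∧
        ∀ T ∈ Θ, ∀ x ∈ T, ∀ y ∈ T, ∀ w ∈ T, x ≠ y → x ∈ A → y ∈ A → w ∉ A →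
          ¬ (φ x ∈ L w ∧ φ y ∈ L w) := by
  induction A using Finset.strongInductionOn with
  | _ A ih =>
    intro Θ hΘ hFΘ
    rcases A.eq_empty_or_nonempty with rfl | hA
    · exact ⟨fun _ => 0, by simp, by simp, by simp⟩
    obtain ⟨𝒬, hΘQ, hQ, hF, hmax⟩ := hFΘ.exists_maximal G
    have h3 : ∀ T ∈ 𝒬, G.IsNClique 3 T := fun T hT =>
      (hQ T hT).elim (fun h => (hΘ T h).1) fun h => h.1
    have h2 : ∀ T ∈ 𝒬, 2 ≤ (T ∩ A).card := by
      intro T hT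
      rcases hQ T hT with h | h
      · exact (hΘ T h).2.ge
      · rw [Finset.inter_eq_left.2 h.2, h.1.card_eq]
        omega
    set E : Finset (Finset V) :=
      Finset.univ.filter fun i => G.IsNClique 2 i ∧ i ⊆ A ∧ ∀ T ∈ 𝒬, ¬ i ⊆ T with hEdef
    have hE : ∀ i ∈ E, G.IsNClique 2 i ∧ i ⊆ A ∧ ∀ T ∈ 𝒬, ¬ i ⊆ T := fun i hi =>
      (Finset.mem_filter.1 hi).2
    have hI : blockRank (E ∪ 𝒬) A ≤ 2 * A.card := by
      have hd : Disjoint E 𝒬 := Finset.disjoint_left.2 fun i hi hi' =>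
        (hE i hi).2.2 i hi' subset_rfl
      refine le_trans (le_of_eq ?_)
        (card_thin_add_blockRank_le hC4 hdens h3 h2 hF hmax hE)
      rw [blockRank, Finset.sum_union hd, blockRank, Finset.card_eq_sum_ones]
      congr 1
      refine Finset.sum_congr rfl fun i hi => ?_
      rw [Finset.inter_eq_left.2 (hE i hi).2.1, (hE i hi).1.card_eq]
    obtain ⟨W, hWA, hW⟩ := exists_proper_maximizer hA hI
    obtain ⟨φ, hφL, hφ, hφT⟩ := ih W hWA (𝒬.filter fun T => (T ∩ W).card = 2)
      (fun T hT => ⟨h3 T (Finset.mem_filter.1 hT).1, (Finset.mem_filter.1 hT).2⟩)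
      (hF.mono (Finset.filter_subset _ _) hWA.subset)
    obtain ⟨ex, hex, huniq, hpaid⟩ := exists_exempt (E ∪ 𝒬)
      (Finset.disjoint_sdiff : Disjoint W (A \ W))
      (fun S hS => by
        have h4 := hW (W ∪ S) (Finset.union_subset hWA.subset (hS.trans Finset.sdiff_subset))
        rw [Finset.card_union_of_disjoint (Finset.disjoint_sdiff.mono_right hS)] at h4
        omega)
    have hstart : IsPartialColoring G L 𝒬 E ex W W φ := by
      refine ⟨hφL, hφ, fun T hT x hx y hy w hw hxy hxW hyW hwW => ?_,
        fun z hz hz' => absurd hz hz', fun T _ z hz x hxT hx =>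
          absurd hx (Finset.disjoint_left.1 (hex z T hz).2.2.2 hxT)⟩
      refine hφT T (Finset.mem_filter.2 ⟨hT, le_antisymm ?_ ?_⟩) x hx y hy w hw hxy hxW hyW hwW
      · have h4 : T ∩ W ⊂ T := Finset.ssubset_iff_subset_ne.2 ⟨Finset.inter_subset_left,
          fun h => hwW (Finset.mem_inter.1 (h.symm ▸ hw)).2⟩
        have h5 := Finset.card_lt_card h4
        rw [(h3 T hT).card_eq] at h5
        omega
      · exact Finset.one_lt_card.2
          ⟨x, Finset.mem_inter.2 ⟨hx, hxW⟩, y, Finset.mem_inter.2 ⟨hy, hyW⟩, hxy⟩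
    have hcov : ∀ x ∈ A, ∀ y ∈ A, G.Adj x y → ∃ i ∈ E ∪ 𝒬, x ∈ i ∧ y ∈ i := by
      intro x hx y hy hxy
      by_cases h : ∃ T ∈ 𝒬, x ∈ T ∧ y ∈ T
      · obtain ⟨T, hT, h⟩ := h
        exact ⟨T, Finset.mem_union_right _ hT, h⟩
      · refine ⟨{x, y}, Finset.mem_union_left _ (Finset.mem_filter.2 ⟨Finset.mem_univ _,
          ⟨by simp [hxy], Finset.card_pair hxy.ne⟩, ?_, fun T hT hsub => h ⟨T, hT, ?_, ?_⟩⟩),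
          by simp, by simp⟩
        · exact Finset.insert_subset hx (Finset.singleton_subset_iff.2 hy)
        · exact hsub (by simp)
        · exact hsub (by simp)
    obtain ⟨ψ, hψ⟩ := hstart.exists_extension hL3 hL1 h3 hF
      (fun i hi => ⟨(hE i hi).1, (hE i hi).2.1⟩) hcov hex huniq hpaid subset_rfl hWA.subset
    exact ⟨ψ, hψ.mem, hψ.proper, fun T hT => hψ.block T (hΘQ hT)⟩

end Hypergraph

theorem noFourCycle_of_not_hasCycleLen {V : Type} {G : SimpleGraph V} (h : ¬ HasCycleLen G 4) :
    NoFourCycle G := by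
  intro x y u w hxy huw hxu hxw hyu hyw
  refine h ⟨x, .cons hxu (.cons hyu.symm (.cons hyw (.cons hxw.symm .nil))), ?_, rfl⟩
  rw [SimpleGraph.Walk.cons_isCycle_iff]
  simp [SimpleGraph.Walk.isPath_def, hxy, hxy.symm, huw, hxu.ne, hxu.ne', hxw.ne,
    hxw.ne', hyu.ne', hyw.ne]

/-- **Theorem.** Every planar graph with no cycle of length 4 is `(3,1)`-choosable. -/
theorem C4free_planar_choosable_3_1 {V : Type} [Fintype V]
    (G : SimpleGraph V) (hplanar : IsPlanar G) (hC4 : ¬ HasCycleLen G 4) :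
    Choosable G 3 1 := by
  intro L hL3 hL1
  obtain ⟨e⟩ := hplanar
  have hG : IsPlaneDrawing e.pos G := ⟨e.inj, e.edges_meet, e.vertex_off⟩
  have hC := noFourCycle_of_not_hasCycleLen hC4
  obtain ⟨φ, hφL, hφ, -⟩ := exists_coloring_of_density hC
    (fun C => card_adj_le_of_drawing hG hC C) hL3 (fun u v huv => by convert hL1 huv)
    Finset.univ ∅ (by simp) (fun X _ hne => by simpa [blockRank] using hne)
  exact ⟨φ, fun v => hφL v (Finset.mem_univ v),
    fun u v huv => hφ u (Finset.mem_univ u) v (Finset.mem_univ v) huv⟩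

end ChoosSep
end
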